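/- Let 1 ≤ q < ∞ and let (X, υ) be a compact metric measure space such that X is a geodesic space, (X, υ) satisfies the doubling condition for some κ > 0, and (X, υ) satisfies the (1, q)-Poincaré inequality for some τ > 0. Then the function r ↦ λ_{1,r}(X) on [1, ∞) is right-continuous at q, i.e., λ_{1,r}(X) → λ_{1,q}(X) as r → q from the right. -/

import Mathlib

open MeasureTheory Metric Filter Set
open scoped Topology NNReal ENNReal
open Classical

variable {X : Type*} [MetricSpace X]

/-- A real-valued function is Lipschitz (with some constant). -/
def IsLipFun (f : X → ℝ) : Prop := ∃ K : ℝ≥0, LipschitzWith K f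

/-- The pointwise Lipschitz constant `Lip f (x)`:
`0` if `x` is isolated, and otherwise the limit (= infimum, by monotonicity)
as `r → 0` of `sup_{y ∈ B_r(x), y ≠ x} |f x - f y| / dist x y`. -/
noncomputable def pLip (f : X → ℝ) (x : X) : ℝ :=
  if 𝓝[≠] x = ⊥ then 0
  else ⨅ r : Ioi (0:ℝ), sSup ((fun y => |f x - f y| / dist x y) '' (ball x r.1 \ {x}))

/-- `γ` is a (unit-speed) minimal geodesic from `x` to `y`. -/
def IsMinGeodesic (γ : ℝ → X) (x y : X) : Prop :=
  γ 0 = x ∧ γ (dist x y) = y ∧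
    ∀ s ∈ Icc (0:ℝ) (dist x y), ∀ t ∈ Icc (0:ℝ) (dist x y), dist (γ s) (γ t) = |s - t|

/-- A metric space is geodesic if any two points are joined by a minimal geodesic. -/
def IsGeodesicSpace (Y : Type*) [MetricSpace Y] : Prop :=
  ∀ x y : Y, ∃ γ : ℝ → Y, IsMinGeodesic γ x y

section MeasureDefs
variable [MeasurableSpace X] (υ : Measure X)

/-- The doubling condition for `κ`. -/
def DoublingFor (κ : ℝ) : Prop :=
  ∀ x : X, ∀ r : ℝ, 0 < r → υ (ball x (2*r)) ≤ (2:ℝ≥0∞) ^ κ * υ (ball x r)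

/-- The `(q,p)`-Poincaré inequality for `τ` (for Lipschitz functions). -/
def PoincareFor (q p τ : ℝ) : Prop :=
  ∀ x : X, ∀ r : ℝ, 0 < r → ∀ f : X → ℝ, IsLipFun f →
    (⨍ y in ball x r, |f y - ⨍ z in ball x r, f z ∂υ| ^ q ∂υ) ^ (1/q) ≤
      τ * r * ((⨍ y in ball x r, (pLip f y) ^ p ∂υ) ^ (1/p))

/-- `F_g(x,y)`: the infimum over minimal geodesics `γ` from `x` to `y` of
`∫_0^{d(x,y)} g(γ(s)) ds`. -/
noncomputable def segF (g : X → ℝ≥0∞) (x y : X) : ℝ≥0∞ :=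
  ⨅ γ ∈ {γ : ℝ → X | IsMinGeodesic γ x y}, ∫⁻ s in Icc (0:ℝ) (dist x y), g (γ s)

/-- The segment inequality for `lam`. -/
def SegmentIneqFor (lam : ℝ) : Prop :=
  ∀ x : X, ∀ r : ℝ, 0 < r → ∀ g : X → ℝ≥0∞, Measurable g →
    (∫⁻ pr in (ball x r) ×ˢ (ball x r), segF g pr.1 pr.2 ∂(υ.prod υ)) ≤
      ENNReal.ofReal (lam * r) * υ (ball x r) * ∫⁻ z in ball x (3*r), g z ∂υ

/-- The first eigenvalue of the `p`-Laplacian (`∞` if there is no competitor). -/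
noncomputable def lambda1 (p : ℝ) : ℝ≥0∞ :=
  ⨅ f ∈ {f : X → ℝ | IsLipFun f ∧ (∫ x, |f x| ^ p ∂υ) = 1 ∧
      (∫ x, |f x| ^ (p-2) * f x ∂υ) = 0},
    ENNReal.ofReal (∫ x, (pLip f x) ^ p ∂υ)

/-- Minkowski's exterior boundary measure
`υ⁺(A) = liminf_{r → 0+} (υ(B_r(A)) - υ(A))/r`. -/
noncomputable def minkBoundary (A : Set X) : ℝ≥0∞ :=
  Filter.liminf (fun r : ℝ => (υ (thickening r A) - υ A) / ENNReal.ofReal r) (𝓝[>] (0:ℝ))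

/-- The Cheeger constant (`∞` if there is no competitor). -/
noncomputable def cheeger : ℝ≥0∞ :=
  ⨅ A ∈ {A : Set X | MeasurableSet A ∧ 0 < υ A ∧ υ A ≤ 1/2}, minkBoundary υ A / υ A

/-- `λ_{1,p}` for `p ∈ [1, ∞)`, with `λ_{1,1} := h(X)` the Cheeger constant. -/
noncomputable def lam1 (p : ℝ) : ℝ≥0∞ := if p = 1 then cheeger υ else lambda1 υ p

/-- `c_p(f) = inf_{c ∈ ℝ} (∫ |f - c|^p dυ)^{1/p}`. -/
noncomputable def cP (p : ℝ) (f : X → ℝ) : ℝ :=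
  ⨅ c : ℝ, (∫ x, |f x - c| ^ p ∂υ) ^ (1/p)

/-- `M` is a median of `f`. -/
def IsMedian (f : X → ℝ) (M : ℝ) : Prop :=
  (1/2 : ℝ≥0∞) ≤ υ {x | M ≤ f x} ∧ (1/2 : ℝ≥0∞) ≤ υ {x | f x ≤ M}

end MeasureDefs

/-- The global Lipschitz constant `sup_{a ≠ b} |f a - f b| / dist a b`. -/
noncomputable def globalLip (f : X → ℝ) : ℝ :=
  sSup {L : ℝ | ∃ a b : X, a ≠ b ∧ L = |f a - f b| / dist a b}

/-- The supremum of the difference quotients of `f` at `x` over a punctured ball. -/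
noncomputable def slopeSup (f : X → ℝ) (r : ℝ) (x : X) : ℝ :=
  sSup ((fun y => |f x - f y| / dist x y) '' (ball x r \ {x}))

section PointwiseLipschitz

variable {f g : X → ℝ} {K K' : ℝ≥0} {x : X} {r : ℝ}

lemma slopeSup_nonneg (f : X → ℝ) (r : ℝ) (x : X) : 0 ≤ slopeSup f r x := by
  apply Real.sSup_nonneg
  rintro _ ⟨y, -, rfl⟩
  positivity

lemma slope_le_of_lipschitz (hf : LipschitzWith K f) (x y : X) :
    |f x - f y| / dist x y ≤ K := by
  apply div_le_of_le_mul₀ dist_nonneg K.2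
  simpa [Real.dist_eq] using hf.dist_le_mul x y

lemma bddAbove_slopes (hf : LipschitzWith K f) (x : X) (s : Set X) :
    BddAbove ((fun y => |f x - f y| / dist x y) '' s) := by
  refine ⟨K, ?_⟩
  rintro _ ⟨y, -, rfl⟩
  exact slope_le_of_lipschitz hf x y

lemma slopeSup_le (hf : LipschitzWith K f) (r : ℝ) (x : X) : slopeSup f r x ≤ K := by
  apply Real.sSup_le _ K.2
  rintro _ ⟨y, -, rfl⟩
  exact slope_le_of_lipschitz hf x y

lemma abs_sub_le_slopeSup_mul (hf : LipschitzWith K f) {y : X} (hy : y ∈ ball x r) :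
    |f x - f y| ≤ slopeSup f r x * dist x y := by
  rcases eq_or_ne y x with rfl | hne
  · simp
  · have hd : 0 < dist x y := dist_pos.2 hne.symm
    rw [← div_le_iff₀ hd]
    exact le_csSup (bddAbove_slopes hf x _) ⟨y, ⟨hy, hne⟩, rfl⟩

lemma slopeSup_mono (hf : LipschitzWith K f) {r r' : ℝ} (h : r ≤ r') :
    slopeSup f r x ≤ slopeSup f r' x := by
  apply Real.sSup_le _ (slopeSup_nonneg f r' x)
  rintro _ ⟨y, hy, rfl⟩
  exact le_csSup (bddAbove_slopes hf x _) ⟨y, ⟨ball_subset_ball h hy.1, hy.2⟩, rfl⟩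

lemma pLip_eq_iInf (f : X → ℝ) (x : X) : pLip f x = ⨅ r : Ioi (0:ℝ), slopeSup f r.1 x := by
  unfold pLip
  split_ifs with h
  · have hb : BddBelow (range fun r : Ioi (0:ℝ) => slopeSup f r.1 x) :=
      ⟨0, by rintro _ ⟨r, rfl⟩; exact slopeSup_nonneg f _ x⟩
    obtain ⟨ε, hε, hs⟩ := Metric.mem_nhdsWithin_iff.1
      (show (∅ : Set X) ∈ 𝓝[≠] x by rw [h]; exact mem_bot)
    have h0 : slopeSup f ε x = 0 := by
      have : ball x ε \ {x} = ∅ := subset_empty_iff.1 hs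
      simp [slopeSup, this]
    exact le_antisymm (Real.iInf_nonneg fun r => slopeSup_nonneg f _ x)
      ((ciInf_le hb ⟨ε, hε⟩).trans h0.le)
  · rfl

lemma pLip_nonneg (f : X → ℝ) (x : X) : 0 ≤ pLip f x := by
  rw [pLip_eq_iInf]
  exact Real.iInf_nonneg fun r => slopeSup_nonneg f _ x

lemma tendsto_slopeSup (hf : LipschitzWith K f) (x : X) :
    Tendsto (fun r => slopeSup f r x) (𝓝[>] 0) (𝓝 (pLip f x)) := by
  have hb : BddBelow (range fun r : Ioi (0:ℝ) => slopeSup f r.1 x) :=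
    ⟨0, by rintro _ ⟨r, rfl⟩; exact slopeSup_nonneg f _ x⟩
  rw [pLip_eq_iInf]
  have hle : ∀ r : ℝ, 0 < r → (⨅ r : Ioi (0:ℝ), slopeSup f r.1 x) ≤ slopeSup f r x :=
    fun r hr => ciInf_le hb ⟨r, hr⟩
  refine tendsto_order.2 ⟨fun a ha => ?_, fun a ha => ?_⟩
  · filter_upwards [self_mem_nhdsWithin] with r hr using ha.trans_le (hle r hr)
  · obtain ⟨⟨ε, hε⟩, h⟩ := exists_lt_of_ciInf_lt ha
    filter_upwards [Ioo_mem_nhdsGT hε] with r hr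
    exact (slopeSup_mono hf hr.2.le).trans_lt h

lemma pLip_le (hf : LipschitzWith K f) (x : X) : pLip f x ≤ K :=
  le_of_tendsto (tendsto_slopeSup hf x) (Eventually.of_forall fun r => slopeSup_le hf r x)

lemma pLip_le_mul_pLip (hf : LipschitzWith K f) (hg : LipschitzWith K' g) {a : ℝ} (ha : 0 ≤ a)
    (h : ∀ᶠ y in 𝓝 x, |g x - g y| ≤ a * |f x - f y|) : pLip g x ≤ a * pLip f x := by
  refine le_of_tendsto_of_tendsto (tendsto_slopeSup hg x)
    ((tendsto_slopeSup hf x).const_mul a) ?_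
  obtain ⟨ε, hε, hs⟩ := Metric.eventually_nhds_iff_ball.1 h
  filter_upwards [Ioo_mem_nhdsGT hε] with r hr
  apply Real.sSup_le _ (mul_nonneg ha (slopeSup_nonneg f r x))
  rintro _ ⟨y, hy, rfl⟩
  calc |g x - g y| / dist x y ≤ (a * |f x - f y|) / dist x y := by
        gcongr; exact hs y (ball_subset_ball hr.2.le hy.1)
    _ = a * (|f x - f y| / dist x y) := mul_div_assoc _ _ _
    _ ≤ a * slopeSup f r x := by
        gcongr; exact le_csSup (bddAbove_slopes hf x _) ⟨y, hy, rfl⟩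

lemma pLip_eq_zero_of_eventually_eq (hf : LipschitzWith K f) (h : ∀ᶠ y in 𝓝 x, f y = f x) :
    pLip f x = 0 := by
  refine le_antisymm ?_ (pLip_nonneg f x)
  simpa using pLip_le_mul_pLip hf hf le_rfl (by filter_upwards [h] with y hy using by simp [hy])

lemma lowerSemicontinuous_slopeSup (hf : LipschitzWith K f) (r : ℝ) :
    LowerSemicontinuous (slopeSup f r) := by
  intro x a ha
  rcases lt_or_ge a 0 with h0 | h0
  · exact Eventually.of_forall fun y => h0.trans_le (slopeSup_nonneg f r y)
  · have hne : ((fun y => |f x - f y| / dist x y) '' (ball x r \ {x})).Nonempty := by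
      by_contra hemp
      rw [not_nonempty_iff_eq_empty] at hemp
      rw [slopeSup, hemp, Real.sSup_empty] at ha
      exact absurd ha h0.not_gt
    obtain ⟨_, ⟨y, hy, rfl⟩, hay⟩ := exists_lt_of_lt_csSup hne ha
    have hyx : y ≠ x := hy.2
    have hc : ContinuousAt (fun z => |f z - f y| / dist z y) x :=
      ((hf.continuous.continuousAt.sub continuousAt_const).abs).div
        (continuousAt_id.dist continuousAt_const) (dist_pos.2 hyx.symm).ne'
    have h1 : ∀ᶠ z in 𝓝 x, y ∈ ball z r := by
      filter_upwards [isOpen_ball.mem_nhds (mem_ball_comm.1 hy.1)] with z hz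
        using mem_ball_comm.1 hz
    filter_upwards [hc.eventually (lt_mem_nhds hay), h1, isOpen_ne.mem_nhds hyx.symm]
      with z hz hz1 hz2
    exact hz.trans_le (le_csSup (bddAbove_slopes hf z _) ⟨y, ⟨hz1, hz2.symm⟩, rfl⟩)

lemma measurable_slopeSup [MeasurableSpace X] [BorelSpace X] (hf : LipschitzWith K f) (r : ℝ) :
    Measurable (slopeSup f r) :=
  (lowerSemicontinuous_slopeSup hf r).measurable

lemma tendsto_one_div_add_one_nhdsGT :
    Tendsto (fun n : ℕ => 1 / ((n : ℝ) + 1)) atTop (𝓝[>] 0) :=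
  tendsto_nhdsWithin_iff.2 ⟨tendsto_one_div_add_atTop_nhds_zero_nat,
    Eventually.of_forall fun n => by simp only [mem_Ioi]; positivity⟩

lemma measurable_pLip [MeasurableSpace X] [BorelSpace X] (hf : LipschitzWith K f) :
    Measurable (pLip f) :=
  measurable_of_tendsto_metrizable (fun n : ℕ => measurable_slopeSup hf (1 / ((n : ℝ) + 1)))
    (tendsto_pi_nhds.2 fun x => (tendsto_slopeSup hf x).comp tendsto_one_div_add_one_nhdsGT)

lemma integrable_pLip_rpow [MeasurableSpace X] [BorelSpace X] (υ : Measure X)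
    [IsFiniteMeasure υ] (hf : LipschitzWith K f) {p : ℝ} (hp : 0 ≤ p) :
    Integrable (fun x => pLip f x ^ p) υ := by
  refine Integrable.of_bound ((measurable_pLip hf).pow_const p).aestronglyMeasurable
    ((K : ℝ) ^ p) (Eventually.of_forall fun x => ?_)
  rw [Real.norm_of_nonneg (Real.rpow_nonneg (pLip_nonneg f x) p)]
  exact Real.rpow_le_rpow (pLip_nonneg f x) (pLip_le hf x) hp

end PointwiseLipschitz

section SignedPower

lemma abs_rpow_sub_two_mul_self {p : ℝ} (hp : 1 < p) (t : ℝ) :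
    |t| ^ (p - 2) * t = max t 0 ^ (p - 1) - max (-t) 0 ^ (p - 1) := by
  have hp1 : p - 1 ≠ 0 := by linarith
  rcases lt_trichotomy t 0 with h | rfl | h
  · rw [abs_of_neg h, max_eq_right h.le, max_eq_left (by linarith), Real.zero_rpow hp1,
      show p - 1 = (p - 2) + 1 by ring, Real.rpow_add_one (by linarith)]
    ring
  · simp
  · rw [abs_of_pos h, max_eq_left h.le, max_eq_right (by linarith), Real.zero_rpow hp1,
      show p - 1 = (p - 2) + 1 by ring, Real.rpow_add_one h.ne']
    ring

lemma abs_rpow_sub_two_mul_abs {p : ℝ} (hp : 1 < p) (t : ℝ) :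
    |t| ^ (p - 2) * |t| = |t| ^ (p - 1) := by
  have h := abs_rpow_sub_two_mul_self hp |t|
  rwa [abs_abs, max_eq_left (abs_nonneg t), max_eq_right (by simp),
    Real.zero_rpow (by linarith), sub_zero] at h

lemma continuous_abs_rpow_sub_two_mul_self {p : ℝ} (hp : 1 < p) :
    Continuous fun t : ℝ => |t| ^ (p - 2) * t := by
  simp_rw [abs_rpow_sub_two_mul_self hp]
  have hp1 : 0 ≤ p - 1 := by linarith
  exact ((continuous_id.max continuous_const).rpow_const fun _ => Or.inr hp1).sub
    ((continuous_neg.max continuous_const).rpow_const fun _ => Or.inr hp1)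

lemma continuous_abs_sub_rpow {f : X → ℝ} (hf : Continuous f) (c : ℝ) {p : ℝ} (hp : 0 ≤ p) :
    Continuous fun x => |f x - c| ^ p :=
  ((hf.sub continuous_const).abs).rpow_const fun _ => Or.inr hp

end SignedPower

section Eigenvalue

variable [CompactSpace X] [MeasurableSpace X] [BorelSpace X] (υ : Measure X)

lemma Continuous.integrable_of_compactSpace [IsFiniteMeasure υ] {f : X → ℝ}
    (hf : Continuous f) : Integrable f υ :=
  hf.integrable_of_hasCompactSupport (HasCompactSupport.of_compactSpace f)

/-- A normalized competitor for `lambda1` realizes the distance to the constants in `L^p`. -/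
lemma one_le_integral_abs_sub_rpow [IsFiniteMeasure υ] {p : ℝ} (hp : 1 < p) {f : X → ℝ}
    (hf : Continuous f) (h1 : ∫ x, |f x| ^ p ∂υ = 1) (h0 : ∫ x, |f x| ^ (p - 2) * f x ∂υ = 0)
    (c : ℝ) : 1 ≤ ∫ x, |f x - c| ^ p ∂υ := by
  have hp0 : 0 < p := by linarith
  have hpq : (p / (p - 1)).HolderConjugate p := (Real.HolderConjugate.conjExponent hp).symm
  have hc1 : Continuous fun x => |f x| ^ (p - 2) * f x :=
    (continuous_abs_rpow_sub_two_mul_self hp).comp hf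
  have hcp : Continuous fun x => |f x| ^ p := hf.abs.rpow_const fun _ => Or.inr hp0.le
  have hcc := continuous_abs_sub_rpow hf c hp0.le
  have hpt : ∀ x, |f x| ^ p - c * (|f x| ^ (p - 2) * f x) ≤
      ((p - 1) / p) * |f x| ^ p + (1 / p) * |f x - c| ^ p := by
    intro x
    have h2 : |f x| ^ p = |f x| ^ (p - 2) * f x * f x := by
      have : |f x| ^ p = |f x| ^ (p - 1) * |f x| := by
        rw [← Real.rpow_add_one' (abs_nonneg _) (by linarith)]; congr 1; ring
      rw [this, ← abs_rpow_sub_two_mul_abs hp, mul_assoc, mul_assoc, abs_mul_abs_self]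
    have h3 : |f x| ^ p - c * (|f x| ^ (p - 2) * f x) =
        |f x| ^ (p - 2) * f x * (f x - c) := by rw [h2]; ring
    rw [h3]
    refine (le_abs_self _).trans ?_
    have habs : |(|f x| ^ (p - 2) * f x)| = |f x| ^ (p - 1) := by
      rw [abs_mul, abs_of_nonneg (Real.rpow_nonneg (abs_nonneg _) _), abs_rpow_sub_two_mul_abs hp]
    rw [abs_mul, habs]
    refine (Real.young_inequality_of_nonneg (Real.rpow_nonneg (abs_nonneg _) _)
      (abs_nonneg _) hpq).trans_eq ?_
    rw [← Real.rpow_mul (abs_nonneg _), mul_div_cancel₀ _ (by linarith)]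
    field_simp
  have i1 := hc1.integrable_of_compactSpace υ
  have ip := hcp.integrable_of_compactSpace υ
  have ic := hcc.integrable_of_compactSpace υ
  have hineq := integral_mono (μ := υ) (f := fun x => |f x| ^ p - c * (|f x| ^ (p - 2) * f x))
    (g := fun x => ((p - 1) / p) * |f x| ^ p + (1 / p) * |f x - c| ^ p)
    (ip.sub (i1.const_mul c)) ((ip.const_mul _).add (ic.const_mul _)) hpt
  rw [integral_sub ip (i1.const_mul c), integral_add (ip.const_mul _) (ic.const_mul _),
    integral_const_mul, integral_const_mul, integral_const_mul, h1, h0] at hineq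
  have : 1 / p ≤ 1 / p * ∫ x, |f x - c| ^ p ∂υ := by
    have h4 : (p - 1) / p = 1 - 1 / p := by field_simp
    rw [h4] at hineq
    linarith
  exact (le_mul_iff_one_le_right (by positivity)).1 this

lemma exists_integral_signed_rpow_eq_zero [IsFiniteMeasure υ] {p : ℝ} (hp : 1 < p) {f : X → ℝ}
    (hf : Continuous f) : ∃ c : ℝ, ∫ x, |f x - c| ^ (p - 2) * (f x - c) ∂υ = 0 := by
  obtain ⟨M, hM⟩ := isCompact_univ.exists_bound_of_continuousOn hf.continuousOn
  have hM' : ∀ x, |f x| ≤ M := fun x => hM x (mem_univ x)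
  have hcont : Continuous fun c : ℝ => ∫ x, |f x - c| ^ (p - 2) * (f x - c) ∂υ := by
    have := continuous_parametric_integral_of_continuous (μ := υ)
      (f := fun (c : ℝ) (x : X) => |f x - c| ^ (p - 2) * (f x - c))
      ((continuous_abs_rpow_sub_two_mul_self hp).comp
        ((hf.comp continuous_snd).sub continuous_fst)) isCompact_univ
    simpa using this
  have hlo : 0 ≤ ∫ x, |f x - (-M)| ^ (p - 2) * (f x - (-M)) ∂υ :=
    integral_nonneg fun x => mul_nonneg (Real.rpow_nonneg (abs_nonneg _) _)
      (by linarith [(abs_le.1 (hM' x)).1])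
  have hhi : ∫ x, |f x - M| ^ (p - 2) * (f x - M) ∂υ ≤ 0 :=
    integral_nonpos fun x => mul_nonpos_of_nonneg_of_nonpos (Real.rpow_nonneg (abs_nonneg _) _)
      (by linarith [(abs_le.1 (hM' x)).2])
  exact mem_range_of_exists_le_of_exists_ge hcont ⟨M, hhi⟩ ⟨-M, hlo⟩

lemma lambda1_mul_integral_le [IsFiniteMeasure υ] {p : ℝ} (hp : 1 < p) {f : X → ℝ} {K : ℝ≥0}
    (hf : LipschitzWith K f) : ∃ c : ℝ,
      lambda1 υ p * ENNReal.ofReal (∫ x, |f x - c| ^ p ∂υ) ≤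
        ENNReal.ofReal (∫ x, pLip f x ^ p ∂υ) := by
  have hp0 : 0 < p := by linarith
  obtain ⟨c, hc⟩ := exists_integral_signed_rpow_eq_zero υ hp hf.continuous
  refine ⟨c, ?_⟩
  set N := ∫ x, |f x - c| ^ p ∂υ with hN
  have hN0 : 0 ≤ N := integral_nonneg fun x => Real.rpow_nonneg (abs_nonneg _) _
  rcases hN0.eq_or_lt with h | h
  · rw [← h]; simp
  set a : ℝ := N ^ (-(1 / p)) with ha
  have ha0 : 0 < a := Real.rpow_pos_of_pos h _
  have hap : a ^ p = N⁻¹ := by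
    rw [ha, ← Real.rpow_mul h.le, neg_mul, one_div_mul_cancel hp0.ne', Real.rpow_neg_one]
  have hdiff : ∀ x y, |a * (f x - c) - a * (f y - c)| = a * |f x - f y| := by
    intro x y
    rw [← mul_sub, abs_mul, abs_of_pos ha0]; congr 2; ring
  have hg : LipschitzWith (a.toNNReal * K) fun x => a * (f x - c) := by
    refine LipschitzWith.of_dist_le_mul fun x y => ?_
    rw [Real.dist_eq, hdiff, NNReal.coe_mul, Real.coe_toNNReal a ha0.le, mul_assoc]
    gcongr
    simpa [Real.dist_eq] using hf.dist_le_mul x y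
  have hle : lambda1 υ p ≤ ENNReal.ofReal (∫ x, pLip (fun x => a * (f x - c)) x ^ p ∂υ) := by
    refine iInf₂_le _ ⟨⟨_, hg⟩, ?_, ?_⟩
    · calc ∫ x, |a * (f x - c)| ^ p ∂υ = ∫ x, a ^ p * |f x - c| ^ p ∂υ := by
            congr 1; ext x
            rw [abs_mul, abs_of_pos ha0, Real.mul_rpow ha0.le (abs_nonneg _)]
        _ = 1 := by rw [integral_const_mul, hap, ← hN, inv_mul_cancel₀ h.ne']
    · calc ∫ x, |a * (f x - c)| ^ (p - 2) * (a * (f x - c)) ∂υ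
          = ∫ x, (a ^ (p - 2) * a) * (|f x - c| ^ (p - 2) * (f x - c)) ∂υ := by
            congr 1; ext x
            rw [abs_mul, abs_of_pos ha0, Real.mul_rpow ha0.le (abs_nonneg _)]; ring
        _ = 0 := by rw [integral_const_mul, hc, mul_zero]
  have hE : ∫ x, pLip (fun x => a * (f x - c)) x ^ p ∂υ ≤ N⁻¹ * ∫ x, pLip f x ^ p ∂υ := by
    rw [← integral_const_mul]
    refine integral_mono (integrable_pLip_rpow υ hg hp0.le)
      ((integrable_pLip_rpow υ hf hp0.le).const_mul _) fun x => ?_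
    dsimp only
    rw [← hap, ← Real.mul_rpow ha0.le (pLip_nonneg f x)]
    exact Real.rpow_le_rpow (pLip_nonneg _ x)
      (pLip_le_mul_pLip hf hg ha0.le (Eventually.of_forall fun y => (hdiff x y).le)) hp0.le
  calc lambda1 υ p * ENNReal.ofReal N
      ≤ ENNReal.ofReal (N⁻¹ * ∫ x, pLip f x ^ p ∂υ) * ENNReal.ofReal N := by
        gcongr; exact hle.trans (ENNReal.ofReal_le_ofReal hE)
    _ = ENNReal.ofReal (∫ x, pLip f x ^ p ∂υ) := by
        rw [← ENNReal.ofReal_mul' h.le]; congr 1; field_simp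

end Eigenvalue

lemma rpow_integral_le_integral_rpow {Ω : Type*} [MeasurableSpace Ω] (μ : Measure Ω)
    [IsProbabilityMeasure μ] {h : Ω → ℝ} {t : ℝ} (ht : 1 ≤ t)
    (h0 : ∀ x, 0 ≤ h x) (hi : Integrable h μ) (hit : Integrable (fun x => h x ^ t) μ) :
    (∫ x, h x ∂μ) ^ t ≤ ∫ x, h x ^ t ∂μ :=
  (convexOn_rpow ht).map_integral_le (Real.continuous_rpow_const (by linarith)).continuousOn
    isClosed_Ici (Eventually.of_forall h0) hi hit

lemma rpow_integral_rpow_le {Ω : Type*} [MeasurableSpace Ω] (μ : Measure Ω)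
    [IsProbabilityMeasure μ] {h : Ω → ℝ} {q r : ℝ} (hq : 0 < q)
    (hqr : q ≤ r) (h0 : ∀ x, 0 ≤ h x) (hiq : Integrable (fun x => h x ^ q) μ)
    (hir : Integrable (fun x => h x ^ r) μ) :
    (∫ x, h x ^ q ∂μ) ^ (r / q) ≤ ∫ x, h x ^ r ∂μ := by
  have he : ∀ x, (h x ^ q) ^ (r / q) = h x ^ r := fun x => by
    rw [← Real.rpow_mul (h0 x), mul_div_cancel₀ _ hq.ne']
  have := rpow_integral_le_integral_rpow μ ((one_le_div hq).2 hqr)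
    (fun x => Real.rpow_nonneg (h0 x) q) hiq (by simpa only [he] using hir)
  simpa only [he] using this

lemma abs_sub_rpow_le {s : ℝ} (hs : 0 ≤ s) (x m c : ℝ) :
    |x - c| ^ s ≤ 2 ^ s * (|x - m| ^ s + |m - c| ^ s) := by
  have h1 : |x - c| ≤ 2 * max |x - m| |m - c| := by
    have := abs_sub_le x m c
    have := le_max_left |x - m| |m - c|
    have := le_max_right |x - m| |m - c|
    linarith
  have h2 : max |x - m| |m - c| ^ s ≤ |x - m| ^ s + |m - c| ^ s := by
    have := Real.rpow_nonneg (abs_nonneg (x - m)) s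
    have := Real.rpow_nonneg (abs_nonneg (m - c)) s
    rcases max_cases |x - m| |m - c| with h | h <;> rw [h.1] <;> linarith
  calc |x - c| ^ s ≤ (2 * max |x - m| |m - c|) ^ s := by gcongr
    _ = 2 ^ s * max |x - m| |m - c| ^ s := Real.mul_rpow (by norm_num) (by positivity)
    _ ≤ _ := by gcongr

lemma continuousAt_integral_pLip_rpow [MeasurableSpace X] [BorelSpace X] (υ : Measure X)
    [IsFiniteMeasure υ] {q : ℝ} (hq : 0 < q) {f : X → ℝ}
    {K : ℝ≥0} (hf : LipschitzWith K f) :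
    ContinuousAt (fun r : ℝ => ∫ x, pLip f x ^ r ∂υ) q := by
  refine continuousAt_of_dominated (bound := fun _ => max 1 (K : ℝ) ^ (q + 1)) ?_ ?_
    (integrable_const _) ?_
  · exact Eventually.of_forall fun r => ((measurable_pLip hf).pow_const r).aestronglyMeasurable
  · filter_upwards [Ioo_mem_nhds hq (lt_add_one q)] with r hr
    refine Eventually.of_forall fun x => ?_
    rw [Real.norm_of_nonneg (Real.rpow_nonneg (pLip_nonneg f x) r)]
    calc pLip f x ^ r ≤ max 1 (K : ℝ) ^ r :=
          Real.rpow_le_rpow (pLip_nonneg f x) ((pLip_le hf x).trans (le_max_right _ _)) hr.1.le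
      _ ≤ _ := Real.rpow_le_rpow_of_exponent_le (le_max_left _ _) hr.2.le
  · exact Eventually.of_forall fun x => Real.continuousAt_const_rpow' hq.ne'

section Comparison

variable [CompactSpace X] [MeasurableSpace X] [BorelSpace X] (υ : Measure X)

/-- Log-convexity of `r ↦ ∫ u ^ r` for continuous `u ≥ 0`. -/
lemma integral_rpow_le_interpolate [IsFiniteMeasure υ] {u : X → ℝ} (hu : Continuous u)
    (h0 : ∀ x, 0 ≤ u x) {q s θ : ℝ} (hq : 0 < q) (hs : 0 < s) (hθ0 : 0 < θ) (hθ1 : θ < 1) :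
    ∫ x, u x ^ (q * θ + s * (1 - θ)) ∂υ ≤
      (∫ x, u x ^ q ∂υ) ^ θ * (∫ x, u x ^ s ∂υ) ^ (1 - θ) := by
  have hθ' : 0 < 1 - θ := by linarith
  have hpq : (1 / θ).HolderConjugate (1 / (1 - θ)) := by
    rw [one_div, one_div]
    exact Real.HolderConjugate.inv_inv hθ0 hθ' (by ring)
  have c1 : Continuous fun x => u x ^ (q * θ) := hu.rpow_const fun _ => Or.inr (by positivity)
  have c2 : Continuous fun x => u x ^ (s * (1 - θ)) :=
    hu.rpow_const fun _ => Or.inr (by positivity)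
  have key := integral_mul_le_Lp_mul_Lq_of_nonneg (μ := υ) hpq
    (f := fun x => u x ^ (q * θ)) (g := fun x => u x ^ (s * (1 - θ)))
    (Eventually.of_forall fun x => Real.rpow_nonneg (h0 x) _)
    (Eventually.of_forall fun x => Real.rpow_nonneg (h0 x) _)
    (c1.memLp_of_hasCompactSupport (HasCompactSupport.of_compactSpace _))
    (c2.memLp_of_hasCompactSupport (HasCompactSupport.of_compactSpace _))
  have e1 : ∀ x, u x ^ (q * θ) * u x ^ (s * (1 - θ)) = u x ^ (q * θ + s * (1 - θ)) := fun x =>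
    (Real.rpow_add_of_nonneg (h0 x) (by positivity) (by positivity)).symm
  have e2 : ∀ x, (u x ^ (q * θ)) ^ (1 / θ) = u x ^ q := fun x => by
    rw [← Real.rpow_mul (h0 x)]; congr 1; field_simp
  have e3 : ∀ x, (u x ^ (s * (1 - θ))) ^ (1 / (1 - θ)) = u x ^ s := fun x => by
    rw [← Real.rpow_mul (h0 x)]; congr 1; field_simp
  simpa only [e1, e2, e3, one_div_one_div] using key

lemma integral_abs_sub_rpow_le_of_sobolev [IsProbabilityMeasure υ] {q s b C c : ℝ} (hq : 1 ≤ q)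
    (hqs : q < s) (hb : 0 < b) {f : X → ℝ} (hf : Continuous f) {e : ℝ} (he : 0 ≤ e)
    (hS : ∫ x, |f x - ∫ y, f y ∂υ| ^ s ∂υ ≤ C * e ^ (s / q))
    (hc : b * ∫ x, |f x - c| ^ q ∂υ ≤ e) :
    ∫ x, |f x - c| ^ s ∂υ ≤ 2 ^ s * (C + b⁻¹ ^ (s / q)) * e ^ (s / q) := by
  have hq0 : 0 < q := by linarith
  have hs0 : 0 < s := by linarith
  set m := ∫ y, f y ∂υ with hm
  have hi : ∀ (c p : ℝ), 0 ≤ p → Integrable (fun x => |f x - c| ^ p) υ := fun c p hp =>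
    (continuous_abs_sub_rpow hf c hp).integrable_of_compactSpace υ
  have hfi := hf.integrable_of_compactSpace υ
  have h1 : |m - c| ≤ ∫ x, |f x - c| ∂υ := by
    have : m - c = ∫ x, (f x - c) ∂υ := by
      rw [integral_sub hfi (integrable_const c)]; simp [hm]
    rw [this]
    exact abs_integral_le_integral_abs
  have h2 : |m - c| ^ q ≤ ∫ x, |f x - c| ^ q ∂υ :=
    (Real.rpow_le_rpow (abs_nonneg _) h1 hq0.le).trans
      (rpow_integral_le_integral_rpow υ hq (fun x => abs_nonneg _)
        (by simpa using hi c 1 zero_le_one) (hi c q hq0.le))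
  have h3 : |m - c| ^ s ≤ b⁻¹ ^ (s / q) * e ^ (s / q) := by
    rw [← Real.mul_rpow (by positivity) he,
      show |m - c| ^ s = (|m - c| ^ q) ^ (s / q) by
        rw [← Real.rpow_mul (abs_nonneg _), mul_div_cancel₀ _ hq0.ne']]
    refine Real.rpow_le_rpow (by positivity) (h2.trans ?_) (by positivity)
    rw [inv_mul_eq_div, le_div_iff₀ hb, mul_comm]
    exact hc
  calc ∫ x, |f x - c| ^ s ∂υ
      ≤ ∫ x, 2 ^ s * (|f x - m| ^ s + |m - c| ^ s) ∂υ :=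
        integral_mono (hi c s hs0.le) (((hi m s hs0.le).add (integrable_const _)).const_mul _)
          fun x => abs_sub_rpow_le hs0.le (f x) m c
    _ = 2 ^ s * (∫ x, |f x - m| ^ s ∂υ + |m - c| ^ s) := by
        rw [integral_const_mul, integral_add (hi m s hs0.le) (integrable_const _)]; simp
    _ ≤ 2 ^ s * (C * e ^ (s / q) + b⁻¹ ^ (s / q) * e ^ (s / q)) := by gcongr
    _ = _ := by ring

lemma le_lambda1_of_sobolev [IsProbabilityMeasure υ] {q s b C : ℝ} (hq : 1 ≤ q) (hqs : q < s)
    (hb : 0 < b) (hC : 0 ≤ C)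
    (hS : ∀ (f : X → ℝ) (K : ℝ≥0), LipschitzWith K f →
      ∫ x, |f x - ∫ y, f y ∂υ| ^ s ∂υ ≤ C * (∫ x, pLip f x ^ q ∂υ) ^ (s / q))
    (hA : ∀ (f : X → ℝ) (K : ℝ≥0), LipschitzWith K f → ∃ c : ℝ,
      ENNReal.ofReal b * ENNReal.ofReal (∫ x, |f x - c| ^ q ∂υ) ≤
        ENNReal.ofReal (∫ x, pLip f x ^ q ∂υ))
    {θ : ℝ} (hθ0 : 0 < θ) (hθ1 : θ < 1) :
    ENNReal.ofReal (b ^ θ / (2 ^ s * (C + b⁻¹ ^ (s / q))) ^ (1 - θ)) ≤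
      lambda1 υ (q * θ + s * (1 - θ)) := by
  have hq0 : 0 < q := by linarith
  have hs0 : 0 < s := by linarith
  have hθ' : 0 < 1 - θ := by linarith
  set r := q * θ + s * (1 - θ) with hr
  have hqr : q < r := by nlinarith
  set D := 2 ^ s * (C + b⁻¹ ^ (s / q)) with hD
  have hD0 : 0 < D := by positivity
  refine le_iInf₂ fun f hf => ?_
  obtain ⟨⟨K, hf⟩, h1, h0⟩ := hf
  apply ENNReal.ofReal_le_ofReal
  obtain ⟨c, hc⟩ := hA f K hf
  set e := ∫ x, pLip f x ^ q ∂υ with he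
  have he0 : 0 ≤ e := integral_nonneg fun x => Real.rpow_nonneg (pLip_nonneg f x) _
  have hc' : b * ∫ x, |f x - c| ^ q ∂υ ≤ e := by
    rwa [← ENNReal.ofReal_mul hb.le, ENNReal.ofReal_le_ofReal_iff he0] at hc
  have hSc := integral_abs_sub_rpow_le_of_sobolev υ hq hqs hb hf.continuous he0 (hS f K hf) hc'
  have hone := one_le_integral_abs_sub_rpow υ (hq.trans_lt hqr) hf.continuous h1 h0 c
  have hineq := integral_rpow_le_interpolate υ (u := fun x => |f x - c|)
    (hf.continuous.sub continuous_const).abs (fun x => abs_nonneg _) hq0 hs0 hθ0 hθ1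
  have hE : e ^ (r / q) ≤ ∫ x, pLip f x ^ r ∂υ :=
    rpow_integral_rpow_le υ hq0 hqr.le (pLip_nonneg f) (integrable_pLip_rpow υ hf hq0.le)
      (integrable_pLip_rpow υ hf (by linarith))
  set a := ∫ x, |f x - c| ^ q ∂υ with ha
  set S := ∫ x, |f x - c| ^ s ∂υ with hSdef
  have ha0 : 0 ≤ a := integral_nonneg fun x => Real.rpow_nonneg (abs_nonneg _) _
  have hS0 : 0 ≤ S := integral_nonneg fun x => Real.rpow_nonneg (abs_nonneg _) _
  rw [div_le_iff₀ (by positivity)]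
  calc b ^ θ = b ^ θ * 1 := (mul_one _).symm
    _ ≤ b ^ θ * (a ^ θ * S ^ (1 - θ)) := by gcongr; exact hone.trans hineq
    _ = (b * a) ^ θ * S ^ (1 - θ) := by rw [Real.mul_rpow hb.le ha0]; ring
    _ ≤ e ^ θ * (D * e ^ (s / q)) ^ (1 - θ) := by gcongr
    _ = (e ^ θ * e ^ ((s / q) * (1 - θ))) * D ^ (1 - θ) := by
        rw [Real.mul_rpow hD0.le (by positivity), ← Real.rpow_mul he0]; ring
    _ = e ^ (r / q) * D ^ (1 - θ) := by
        rw [← Real.rpow_add_of_nonneg he0 hθ0.le (by positivity)]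
        congr 2; rw [hr]; field_simp
    _ ≤ _ := by gcongr

lemma lambda1_le_integral_pLip [IsProbabilityMeasure υ] {q r : ℝ} (hq : 1 < q) (hqr : q ≤ r)
    {f : X → ℝ} {K : ℝ≥0} (hf : LipschitzWith K f) (h1 : ∫ x, |f x| ^ q ∂υ = 1)
    (h0 : ∫ x, |f x| ^ (q - 2) * f x ∂υ = 0) :
    lambda1 υ r ≤ ENNReal.ofReal (∫ x, pLip f x ^ r ∂υ) := by
  have hq0 : 0 < q := by linarith
  obtain ⟨c, hc⟩ := lambda1_mul_integral_le υ (hq.trans_le hqr) hf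
  have hN : 1 ≤ ∫ x, |f x - c| ^ r ∂υ :=
    calc (1 : ℝ) ≤ (∫ x, |f x - c| ^ q ∂υ) ^ (r / q) :=
          Real.one_le_rpow (one_le_integral_abs_sub_rpow υ hq hf.continuous h1 h0 c)
            (div_nonneg (by linarith) hq0.le)
      _ ≤ _ := rpow_integral_rpow_le υ hq0 hqr (fun x => abs_nonneg _)
          ((continuous_abs_sub_rpow hf.continuous c hq0.le).integrable_of_compactSpace υ)
          ((continuous_abs_sub_rpow hf.continuous c (by linarith)).integrable_of_compactSpace υ)
  refine le_trans ?_ hc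
  refine le_mul_of_one_le_right' ?_
  rw [← ENNReal.ofReal_one]
  exact ENNReal.ofReal_le_ofReal hN

lemma eventually_lambda1_lt [IsProbabilityMeasure υ] {q : ℝ} (hq : 1 < q) {M : ℝ≥0∞}
    (hM : lambda1 υ q < M) : ∀ᶠ r in 𝓝[>] q, lambda1 υ r < M := by
  obtain ⟨f, hf⟩ := iInf_lt_iff.1 hM
  obtain ⟨⟨⟨K, hf⟩, h1, h0⟩, hlt⟩ := iInf_lt_iff.1 hf
  have hc := (ENNReal.continuous_ofReal.continuousAt.comp
    (continuousAt_integral_pLip_rpow υ (by linarith) hf)).eventually (gt_mem_nhds hlt)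
  filter_upwards [hc.filter_mono nhdsWithin_le_nhds, self_mem_nhdsWithin] with r hr hqr
  exact (lambda1_le_integral_pLip υ hq (le_of_lt hqr) hf h1 h0).trans_lt hr

end Comparison

lemma exists_median {Ω : Type*} [MeasurableSpace Ω] (μ : Measure Ω) [IsProbabilityMeasure μ]
    {f : Ω → ℝ} (hf : Measurable f) {B : ℝ}
    (hB : ∀ x, |f x| ≤ B) : ∃ M : ℝ, μ {x | M < f x} ≤ 1 / 2 ∧ μ {x | f x < M} ≤ 1 / 2 := by
  set T : Set ℝ := {t | μ {x | t < f x} ≤ 1 / 2} with hT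
  have hne : T.Nonempty := by
    refine ⟨B, ?_⟩
    have : {x | B < f x} = ∅ := by
      ext x
      simpa using (le_abs_self _).trans (hB x)
    simp [hT, this]
  have hbdd : BddBelow T := by
    refine ⟨-B, fun t ht => ?_⟩
    by_contra hlt
    have : {x | t < f x} = univ := by
      ext x
      simpa using (not_le.1 hlt).trans_le (abs_le.1 (hB x)).1
    simp only [hT, mem_ofPred_eq, this, measure_univ] at ht
    exact absurd ht (by simp)
  set M := sInf T with hM
  have hpos : ∀ n : ℕ, (0:ℝ) < 1 / ((n : ℝ) + 1) := fun n => by positivity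
  have hdec : ∀ m n : ℕ, m ≤ n → 1 / ((n : ℝ) + 1) ≤ 1 / ((m : ℝ) + 1) := fun m n h =>
    Nat.one_div_le_one_div h
  refine ⟨M, ?_, ?_⟩
  · have hU : {x | M < f x} = ⋃ n : ℕ, {x | M + 1 / ((n : ℝ) + 1) < f x} := by
      ext x
      simp only [mem_ofPred_eq, mem_iUnion]
      constructor
      · intro hx
        obtain ⟨n, hn⟩ := exists_nat_one_div_lt (sub_pos.2 hx)
        exact ⟨n, by linarith⟩
      · rintro ⟨n, hn⟩
        linarith [hpos n]
    have hmono : Monotone fun n : ℕ => {x | M + 1 / ((n : ℝ) + 1) < f x} := by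
      intro m n hmn x hx
      have := hdec m n hmn
      simp only [mem_ofPred_eq] at hx ⊢
      linarith
    rw [hU, hmono.measure_iUnion]
    refine iSup_le fun n => ?_
    obtain ⟨t, ht, htM⟩ := exists_lt_of_csInf_lt hne (show sInf T < M + 1 / ((n : ℝ) + 1) by
      linarith [hpos n])
    exact (measure_mono fun x hx => htM.trans hx).trans ht
  · have hU : {x | f x < M} = ⋃ n : ℕ, {x | f x < M - 1 / ((n : ℝ) + 1)} := by
      ext x
      simp only [mem_ofPred_eq, mem_iUnion]
      constructor
      · intro hx
        obtain ⟨n, hn⟩ := exists_nat_one_div_lt (sub_pos.2 hx)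
        exact ⟨n, by linarith⟩
      · rintro ⟨n, hn⟩
        linarith [hpos n]
    have hmono : Monotone fun n : ℕ => {x | f x < M - 1 / ((n : ℝ) + 1)} := by
      intro m n hmn x hx
      have := hdec m n hmn
      simp only [mem_ofPred_eq] at hx ⊢
      linarith
    rw [hU, hmono.measure_iUnion]
    refine iSup_le fun n => ?_
    have hnot : M - 1 / ((n : ℝ) + 1) ∉ T := notMem_of_lt_csInf (by linarith [hpos n]) hbdd
    simp only [hT, mem_ofPred_eq, not_le] at hnot
    have hsub : {x | f x < M - 1 / ((n : ℝ) + 1)} ⊆ {x | M - 1 / ((n : ℝ) + 1) < f x}ᶜ :=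
      fun x (hx : f x < _) (hx' : _ < f x) => lt_asymm hx hx'
    refine (measure_mono hsub).trans ?_
    rw [prob_compl_eq_one_sub (measurableSet_lt measurable_const hf), tsub_le_iff_right]
    calc (1 : ℝ≥0∞) = 1 / 2 + 1 / 2 := (ENNReal.add_halves 1).symm
      _ ≤ _ := by gcongr

lemma cheeger_mul_measure_le_minkBoundary [MeasurableSpace X] (υ : Measure X)
    {A : Set X} (hA : MeasurableSet A)
    (h : υ A ≤ 1 / 2) : cheeger υ * υ A ≤ minkBoundary υ A := by
  rcases eq_zero_or_pos (υ A) with h0 | h0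
  · simp [h0]
  · exact ENNReal.mul_le_of_le_div (iInf₂_le A ⟨hA, h0, h⟩)

section Coarea

variable [MeasurableSpace X] [BorelSpace X] (υ : Measure X)

lemma lintegral_measure_thickening_sub_le [SecondCountableTopology X] [SFinite υ] {u : X → ℝ}
    {K : ℝ≥0} (hu : LipschitzWith K u) {ρ : ℝ} (hρ : 0 < ρ) :
    ∫⁻ t : ℝ, (υ (thickening ρ {x | t < u x}) - υ {x | t < u x}) / ENNReal.ofReal ρ ≤
      ∫⁻ x, ENNReal.ofReal (slopeSup u ρ x) ∂υ := by
  set S : Set (X × ℝ) := {z | u z.1 ≤ z.2} ∩ ⋃ y : X, ball y ρ ×ˢ Iio (u y) with hS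
  have hSm : MeasurableSet S :=
    (isClosed_le (hu.continuous.comp continuous_fst) continuous_snd).measurableSet.inter
      (isOpen_iUnion fun y => isOpen_ball.prod isOpen_Iio).measurableSet
  have hslice : ∀ t : ℝ, υ (thickening ρ {x | t < u x}) - υ {x | t < u x} ≤
      υ ((fun x => (x, t)) ⁻¹' S) := by
    intro t
    refine le_measure_sdiff.trans (measure_mono ?_)
    rintro x ⟨hx, hxt⟩
    obtain ⟨y, hy, hxy⟩ := mem_thickening_iff.1 hx
    have hle : u x ≤ t := not_lt.1 fun h => hxt h
    exact ⟨hle, mem_iUnion.2 ⟨y, hxy, hy⟩⟩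
  have hslice' : ∀ x : X, volume (Prod.mk x ⁻¹' S) ≤ ENNReal.ofReal (slopeSup u ρ x * ρ) := by
    intro x
    have hsub : Prod.mk x ⁻¹' S ⊆ Icc (u x) (u x + slopeSup u ρ x * ρ) := by
      rintro t ⟨h1, h2⟩
      obtain ⟨y, hy, hty⟩ := mem_iUnion.1 h2
      refine ⟨h1, ?_⟩
      have hd : dist x y < ρ := hy
      have h3 := abs_sub_le_slopeSup_mul (r := ρ) hu (x := x) (y := y) (by rwa [mem_ball'])
      have h4 : slopeSup u ρ x * dist x y ≤ slopeSup u ρ x * ρ :=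
        mul_le_mul_of_nonneg_left hd.le (slopeSup_nonneg u ρ x)
      have h5 : t < u y := hty
      linarith [neg_abs_le (u x - u y)]
    refine (measure_mono hsub).trans ?_
    rw [Real.volume_Icc, add_sub_cancel_left]
  have hρ0 : ENNReal.ofReal ρ ≠ 0 := by simpa using hρ
  calc ∫⁻ t : ℝ, (υ (thickening ρ {x | t < u x}) - υ {x | t < u x}) / ENNReal.ofReal ρ
      ≤ ∫⁻ t : ℝ, υ ((fun x => (x, t)) ⁻¹' S) * (ENNReal.ofReal ρ)⁻¹ := by
        refine lintegral_mono fun t => ?_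
        rw [div_eq_mul_inv]
        gcongr
        exact hslice t
    _ = (∫⁻ x, volume (Prod.mk x ⁻¹' S) ∂υ) * (ENNReal.ofReal ρ)⁻¹ := by
        rw [lintegral_mul_const' _ _ (ENNReal.inv_ne_top.2 hρ0), ← Measure.prod_apply_symm hSm,
          Measure.prod_apply hSm]
    _ = ∫⁻ x, volume (Prod.mk x ⁻¹' S) * (ENNReal.ofReal ρ)⁻¹ ∂υ :=
        (lintegral_mul_const' _ _ (ENNReal.inv_ne_top.2 hρ0)).symm
    _ ≤ _ := by
        refine lintegral_mono fun x => ?_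
        refine (mul_le_mul_left (hslice' x) _).trans_eq ?_
        rw [ENNReal.ofReal_mul (slopeSup_nonneg u ρ x), mul_assoc,
          ENNReal.mul_inv_cancel hρ0 ENNReal.ofReal_ne_top, mul_one]

/-- The coarea-type inequality for a function whose support has at most half of the mass. -/
lemma cheeger_mul_lintegral_le [SecondCountableTopology X] [IsFiniteMeasure υ] {u : X → ℝ}
    {K : ℝ≥0} (hu : LipschitzWith K u) (h0 : ∀ x, 0 ≤ u x) (hhalf : υ {x | 0 < u x} ≤ 1 / 2) :
    cheeger υ * ∫⁻ x, ENNReal.ofReal (u x) ∂υ ≤ ∫⁻ x, ENNReal.ofReal (pLip u x) ∂υ := by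
  set D : ℕ → ℝ → ℝ≥0∞ := fun n t => (υ (thickening (1 / ((n : ℝ) + 1)) {x | t < u x}) -
    υ {x | t < u x}) / ENNReal.ofReal (1 / ((n : ℝ) + 1)) with hD
  have hanti : Antitone fun t : ℝ => {x | t < u x} := fun s t hst x hx => hst.trans_lt hx
  have hm0 : Measurable fun t : ℝ => υ {x | t < u x} :=
    Antitone.measurable fun s t hst => measure_mono (hanti hst)
  have hmD : ∀ n, Measurable (D n) := fun n =>
    ((Antitone.measurable fun s t hst => measure_mono
      (thickening_subset_of_subset _ (hanti hst))).sub hm0).div_const _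
  have hlevel : ∀ t ∈ Ioi (0:ℝ), cheeger υ * υ {x | t < u x} ≤ liminf (fun n => D n t) atTop := by
    intro t ht
    refine (cheeger_mul_measure_le_minkBoundary υ
      (isOpen_lt continuous_const hu.continuous).measurableSet
      ((measure_mono (hanti (le_of_lt ht))).trans hhalf)).trans ?_
    exact liminf_le_liminf_of_le tendsto_one_div_add_one_nhdsGT
  have hlim : Tendsto (fun n : ℕ => ∫⁻ x, ENNReal.ofReal (slopeSup u (1 / ((n : ℝ) + 1)) x) ∂υ)
      atTop (𝓝 (∫⁻ x, ENNReal.ofReal (pLip u x) ∂υ)) := by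
    refine tendsto_lintegral_of_dominated_convergence (fun _ => ENNReal.ofReal K)
      (fun n => (measurable_slopeSup hu _).ennreal_ofReal) ?_ ?_ ?_
    · exact fun n => Eventually.of_forall fun x => ENNReal.ofReal_le_ofReal (slopeSup_le hu _ x)
    · simpa using ENNReal.mul_ne_top ENNReal.coe_ne_top (measure_ne_top υ univ)
    · exact Eventually.of_forall fun x => (ENNReal.continuous_ofReal.tendsto _).comp
        ((tendsto_slopeSup hu x).comp tendsto_one_div_add_one_nhdsGT)
  calc cheeger υ * ∫⁻ x, ENNReal.ofReal (u x) ∂υ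
      = ∫⁻ t in Ioi (0:ℝ), cheeger υ * υ {x | t < u x} := by
        rw [lintegral_const_mul _ hm0, lintegral_eq_lintegral_meas_lt υ
          (Eventually.of_forall h0) hu.continuous.measurable.aemeasurable]
    _ ≤ ∫⁻ t in Ioi (0:ℝ), liminf (fun n => D n t) atTop :=
        setLIntegral_mono' measurableSet_Ioi hlevel
    _ ≤ liminf (fun n => ∫⁻ t in Ioi (0:ℝ), D n t) atTop := lintegral_liminf_le hmD
    _ ≤ liminf (fun n : ℕ => ∫⁻ x, ENNReal.ofReal (slopeSup u (1 / ((n : ℝ) + 1)) x) ∂υ) atTop :=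
        liminf_le_liminf (Eventually.of_forall fun n =>
          (setLIntegral_le_lintegral _ _).trans
            (lintegral_measure_thickening_sub_le υ hu (by positivity)))
    _ = _ := hlim.liminf_eq

lemma cheeger_mul_lintegral_abs_sub_le [CompactSpace X] [IsProbabilityMeasure υ] {f : X → ℝ}
    {K : ℝ≥0} (hf : LipschitzWith K f) : ∃ c : ℝ,
      cheeger υ * ∫⁻ x, ENNReal.ofReal |f x - c| ∂υ ≤ ∫⁻ x, ENNReal.ofReal (pLip f x) ∂υ := by
  obtain ⟨B, hB⟩ := isCompact_univ.exists_bound_of_continuousOn hf.continuous.continuousOn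
  obtain ⟨M, hM1, hM2⟩ := exists_median υ hf.continuous.measurable fun x => hB x (mem_univ x)
  refine ⟨M, ?_⟩
  set N := ∫⁻ x, ENNReal.ofReal |f x - M| ∂υ with hN
  have hw : LipschitzWith K fun x => max (M - f x) 0 :=
    LipschitzWith.max_const (by simpa using (LipschitzWith.const M).sub hf) 0
  have key : ∀ ε : ℝ, 0 < ε →
      cheeger υ * (N - ENNReal.ofReal ε) ≤ ∫⁻ x, ENNReal.ofReal (pLip f x) ∂υ := by
    intro ε hε
    have hu : LipschitzWith K fun x => max (f x - (M + ε)) 0 :=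
      LipschitzWith.max_const (by simpa using hf.sub (LipschitzWith.const (M + ε))) 0
    have h1 := cheeger_mul_lintegral_le υ hu (fun x => le_max_right _ _)
      ((measure_mono fun x hx => by
        simp only [mem_ofPred_eq, lt_max_iff, lt_self_iff_false, or_false] at hx ⊢
        linarith).trans hM1)
    have h2 := cheeger_mul_lintegral_le υ hw (fun x => le_max_right _ _)
      ((measure_mono fun x hx => by
        simp only [mem_ofPred_eq, lt_max_iff, lt_self_iff_false, or_false] at hx ⊢
        linarith).trans hM2)
    have hNle : N - ENNReal.ofReal ε ≤ (∫⁻ x, ENNReal.ofReal (max (f x - (M + ε)) 0) ∂υ) +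
        ∫⁻ x, ENNReal.ofReal (max (M - f x) 0) ∂υ := by
      rw [tsub_le_iff_right, ← lintegral_add_left hu.continuous.measurable.ennreal_ofReal]
      have : ENNReal.ofReal ε = ∫⁻ _, ENNReal.ofReal ε ∂υ := by simp
      rw [this, ← lintegral_add_right _ measurable_const]
      refine lintegral_mono fun x => ?_
      rw [← ENNReal.ofReal_add (le_max_right _ _) (le_max_right _ _),
        ← ENNReal.ofReal_add (by positivity) hε.le]
      apply ENNReal.ofReal_le_ofReal
      have i1 := le_max_left (f x - (M + ε)) 0
      have i2 := le_max_right (f x - (M + ε)) 0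
      have i3 := le_max_left (M - f x) 0
      have i4 := le_max_right (M - f x) 0
      rw [abs_le]
      constructor <;> linarith
    calc cheeger υ * (N - ENNReal.ofReal ε)
        ≤ cheeger υ * ((∫⁻ x, ENNReal.ofReal (max (f x - (M + ε)) 0) ∂υ) +
          ∫⁻ x, ENNReal.ofReal (max (M - f x) 0) ∂υ) := by gcongr
      _ ≤ (∫⁻ x, ENNReal.ofReal (pLip (fun x => max (f x - (M + ε)) 0) x) ∂υ) +
          ∫⁻ x, ENNReal.ofReal (pLip (fun x => max (M - f x) 0) x) ∂υ := by
          rw [mul_add]; exact add_le_add h1 h2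
      _ = ∫⁻ x, (ENNReal.ofReal (pLip (fun x => max (f x - (M + ε)) 0) x) +
          ENNReal.ofReal (pLip (fun x => max (M - f x) 0) x)) ∂υ :=
          (lintegral_add_left (measurable_pLip hu).ennreal_ofReal _).symm
      _ ≤ _ := by
          refine lintegral_mono fun x => ?_
          rcases lt_or_ge M (f x) with hx | hx
          · have hz : pLip (fun x => max (M - f x) 0) x = 0 := by
              refine pLip_eq_zero_of_eventually_eq hw ?_
              filter_upwards [hf.continuous.continuousAt.eventually (lt_mem_nhds hx)] with y hy
              rw [max_eq_right (by linarith), max_eq_right (by linarith)]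
            rw [hz, ENNReal.ofReal_zero, add_zero]
            refine ENNReal.ofReal_le_ofReal ?_
            simpa using pLip_le_mul_pLip hf hu zero_le_one (Eventually.of_forall fun y => by
              rw [one_mul]
              refine (abs_max_sub_max_le_abs _ _ _).trans_eq ?_
              congr 1; ring)
          · have hz : pLip (fun x => max (f x - (M + ε)) 0) x = 0 := by
              refine pLip_eq_zero_of_eventually_eq hu ?_
              filter_upwards [hf.continuous.continuousAt.eventually
                (gt_mem_nhds (show f x < M + ε by linarith))] with y hy
              rw [max_eq_right (by linarith), max_eq_right (by linarith)]
            rw [hz, ENNReal.ofReal_zero, zero_add]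
            refine ENNReal.ofReal_le_ofReal ?_
            simpa using pLip_le_mul_pLip hf hw zero_le_one (Eventually.of_forall fun y => by
              rw [one_mul]
              refine (abs_max_sub_max_le_abs _ _ _).trans_eq ?_
              rw [abs_sub_comm]; congr 1; ring)
  rcases eq_or_ne N 0 with h0 | h0
  · simp [h0]
  have hNtop : N ≠ ⊤ := (hf.continuous.sub continuous_const).abs.integrable_of_compactSpace υ
    |>.lintegral_lt_top.ne
  have hlim : Tendsto (fun ε : ℝ => cheeger υ * (N - ENNReal.ofReal ε)) (𝓝[>] 0)
      (𝓝 (cheeger υ * N)) := by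
    refine ENNReal.Tendsto.const_mul ?_ (Or.inl h0)
    have : Tendsto (fun ε : ℝ => N - ENNReal.ofReal ε) (𝓝 0) (𝓝 (N - ENNReal.ofReal 0)) :=
      ENNReal.Tendsto.sub tendsto_const_nhds (ENNReal.continuous_ofReal.tendsto 0) (Or.inl hNtop)
    simpa using this.mono_left nhdsWithin_le_nhds
  refine le_of_tendsto hlim ?_
  filter_upwards [self_mem_nhdsWithin] with ε hε using key ε hε

end Coarea

section CheegerUpperBound

/-- The Lipschitz cutoff which is `1` within distance `a` of `A` and `0` beyond distance `b`. -/
noncomputable def annularCutoff (A : Set X) (a b : ℝ) (x : X) : ℝ :=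
  max (min ((b - infDist x A) / (b - a)) 1) 0

lemma lipschitzWith_annularCutoff (A : Set X) {a b : ℝ} (hab : a < b) :
    LipschitzWith (1 / (b - a)).toNNReal (annularCutoff A a b) := by
  refine LipschitzWith.max_const (LipschitzWith.min_const ?_ 1) 0
  refine LipschitzWith.of_dist_le_mul fun x y => ?_
  have h : 0 < b - a := by linarith
  rw [Real.dist_eq, Real.coe_toNNReal _ (by positivity), div_sub_div_same, abs_div,
    abs_of_pos h, one_div, inv_mul_eq_div]
  gcongr
  have := (lipschitz_infDist_pt A).dist_le_mul x y
  rw [Real.dist_eq, NNReal.coe_one, one_mul] at this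
  rwa [sub_sub_sub_cancel_left, abs_sub_comm]

lemma annularCutoff_eq_one (A : Set X) {a b : ℝ} (hab : a < b) {x : X} (hx : infDist x A ≤ a) :
    annularCutoff A a b x = 1 := by
  have h : 0 < b - a := by linarith
  have : 1 ≤ (b - infDist x A) / (b - a) := by rw [le_div_iff₀ h]; linarith
  rw [annularCutoff, min_eq_right this, max_eq_left zero_le_one]

lemma annularCutoff_eq_zero (A : Set X) {a b : ℝ} (hab : a < b) {x : X} (hx : b ≤ infDist x A) :
    annularCutoff A a b x = 0 := by
  have h : 0 < b - a := by linarith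
  have : (b - infDist x A) / (b - a) ≤ 0 := div_nonpos_of_nonpos_of_nonneg (by linarith) h.le
  rw [annularCutoff, max_eq_right ((min_le_left _ _).trans this)]

lemma pLip_annularCutoff_rpow_le (A : Set X) (hA : A.Nonempty) {a b ρ r : ℝ} (ha : 0 < a)
    (hab : a < b) (hb : b < ρ) (hr : 0 < r) (x : X) :
    pLip (annularCutoff A a b) x ^ r ≤
      (thickening ρ A \ A).indicator (fun _ => (1 / (b - a)) ^ r) x := by
  have h : 0 < b - a := by linarith
  have hL := lipschitzWith_annularCutoff A hab
  have hc : Continuous fun x => infDist x A := continuous_infDist_pt A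
  by_cases hx : x ∈ thickening ρ A \ A
  · rw [indicator_of_mem hx]
    refine Real.rpow_le_rpow (pLip_nonneg _ x) ((pLip_le hL x).trans_eq ?_) hr.le
    exact Real.coe_toNNReal _ (by positivity)
  · rw [indicator_of_notMem hx]
    have hz : pLip (annularCutoff A a b) x = 0 := by
      refine pLip_eq_zero_of_eventually_eq hL ?_
      by_cases hxA : x ∈ A
      · have h0 : infDist x A < a := by rwa [infDist_zero_of_mem hxA]
        filter_upwards [hc.continuousAt.eventually (gt_mem_nhds h0)] with y hy
        rw [annularCutoff_eq_one A hab (le_of_lt hy), annularCutoff_eq_one A hab h0.le]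
      · have hxt : x ∉ thickening ρ A := fun h' => hx ⟨h', hxA⟩
        rw [thickening_eq_preimage_infEDist] at hxt
        have h0 : b < infDist x A := by
          refine hb.trans_le ?_
          have h1 : ENNReal.ofReal ρ ≤ infEDist x A := not_lt.1 fun h' => hxt h'
          rwa [ENNReal.ofReal_le_iff_le_toReal (infEDist_ne_top hA)] at h1
        filter_upwards [hc.continuousAt.eventually (lt_mem_nhds h0)] with y hy
        rw [annularCutoff_eq_zero A hab (le_of_lt hy), annularCutoff_eq_zero A hab h0.le]
    rw [hz, Real.zero_rpow hr.ne']

variable [MeasurableSpace X] [BorelSpace X] (υ : Measure X)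

lemma le_integral_abs_annularCutoff_sub [CompactSpace X] [IsProbabilityMeasure υ] {A : Set X}
    (hAm : MeasurableSet A) (hA : A.Nonempty) (hhalf : υ.real A ≤ 1 / 2) {a b ρ : ℝ} (ha : 0 < a)
    (hab : a < b) (hb : b < ρ) (hδ : υ.real (thickening ρ A \ A) ≤ υ.real A) (c : ℝ) :
    υ.real A - υ.real (thickening ρ A \ A) ≤ ∫ x, |annularCutoff A a b x - c| ∂υ := by
  set δ := υ.real (thickening ρ A \ A) with hδdef
  have hTm : MeasurableSet (thickening ρ A) := isOpen_thickening.measurableSet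
  have hAT : A ⊆ thickening ρ A := self_subset_thickening (by linarith) A
  have hT : υ.real (thickening ρ A)ᶜ = 1 - υ.real A - δ := by
    rw [probReal_compl_eq_one_sub hTm, hδdef, measureReal_sdiff hAT hAm]
    ring
  have hpt : ∀ x, A.indicator (fun _ => |1 - c|) x + (thickening ρ A)ᶜ.indicator (fun _ => |c|) x ≤
      |annularCutoff A a b x - c| := by
    intro x
    by_cases hxA : x ∈ A
    · have hxT : x ∉ (thickening ρ A)ᶜ := fun h => h (hAT hxA)
      rw [indicator_of_mem hxA, indicator_of_notMem hxT, add_zero,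
        annularCutoff_eq_one A hab (by rw [infDist_zero_of_mem hxA]; exact ha.le)]
    · rw [indicator_of_notMem hxA, zero_add]
      by_cases hxT : x ∈ (thickening ρ A)ᶜ
      · have h0 : b ≤ infDist x A := by
          have hxT' : x ∉ thickening ρ A := hxT
          rw [thickening_eq_preimage_infEDist] at hxT'
          refine hb.le.trans ?_
          have h1 : ENNReal.ofReal ρ ≤ infEDist x A := not_lt.1 fun h' => hxT' h'
          rwa [ENNReal.ofReal_le_iff_le_toReal (infEDist_ne_top hA)] at h1
        rw [indicator_of_mem hxT, annularCutoff_eq_zero A hab h0]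
        simp
      · rw [indicator_of_notMem hxT]
        exact abs_nonneg _
  have i1 : Integrable (A.indicator fun _ => |1 - c|) υ := (integrable_const _).indicator hAm
  have i2 : Integrable ((thickening ρ A)ᶜ.indicator fun _ => |c|) υ :=
    (integrable_const _).indicator hTm.compl
  have i3 : Integrable (fun x => |annularCutoff A a b x - c|) υ :=
    ((lipschitzWith_annularCutoff A hab).continuous.sub
      continuous_const).abs.integrable_of_compactSpace υ
  have hineq := integral_mono (i1.add i2) i3 hpt
  have hsum : ∫ x, (A.indicator (fun _ => |1 - c|) + (thickening ρ A)ᶜ.indicator fun _ => |c|) x ∂υ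
      = υ.real A * |1 - c| + (1 - υ.real A - δ) * |c| := by
    rw [integral_add' i1 i2, integral_indicator_const _ hAm, integral_indicator_const _ hTm.compl,
      hT, smul_eq_mul, smul_eq_mul]
  rw [hsum] at hineq
  have hδ0 : 0 ≤ δ := measureReal_nonneg
  have htri : 1 ≤ |1 - c| + |c| := by
    have := abs_add_le (1 - c) c
    simpa using this
  have hc1 : 0 ≤ |1 - c| := abs_nonneg _
  have hc2 : 0 ≤ |c| := abs_nonneg _
  nlinarith [mul_nonneg hδ0 hc1, mul_nonneg (sub_nonneg.2 hδ) (sub_nonneg.2 htri)]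

lemma lambda1_le_of_annulus [CompactSpace X] [IsProbabilityMeasure υ] {A : Set X}
    (hAm : MeasurableSet A) (hA : A.Nonempty) (hhalf : υ.real A ≤ 1 / 2) {a b ρ r : ℝ}
    (ha : 0 < a) (hab : a < b) (hb : b < ρ) (hδ : υ.real (thickening ρ A \ A) < υ.real A)
    (hr : 1 < r) :
    lambda1 υ r ≤ ENNReal.ofReal ((1 / (b - a)) ^ r * υ.real (thickening ρ A \ A) /
      (υ.real A - υ.real (thickening ρ A \ A)) ^ r) := by
  have hr0 : 0 < r := by linarith
  have hL := lipschitzWith_annularCutoff A hab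
  obtain ⟨c, hc⟩ := lambda1_mul_integral_le υ hr hL
  have hlow := le_integral_abs_annularCutoff_sub υ hAm hA hhalf ha hab hb hδ.le c
  set δ := υ.real (thickening ρ A \ A) with hδdef
  have hd0 : 0 < υ.real A - δ := by linarith
  have hN : (υ.real A - δ) ^ r ≤ ∫ x, |annularCutoff A a b x - c| ^ r ∂υ := by
    refine (Real.rpow_le_rpow hd0.le hlow hr0.le).trans
      (rpow_integral_le_integral_rpow υ hr.le (fun x => abs_nonneg _) ?_ ?_)
    · exact (hL.continuous.sub continuous_const).abs.integrable_of_compactSpace υ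
    · exact (continuous_abs_sub_rpow hL.continuous c hr0.le).integrable_of_compactSpace υ
  have hTm : MeasurableSet (thickening ρ A \ A) := isOpen_thickening.measurableSet.diff hAm
  have hE : ∫ x, pLip (annularCutoff A a b) x ^ r ∂υ ≤ (1 / (b - a)) ^ r * δ := by
    refine (integral_mono (integrable_pLip_rpow υ hL hr0.le)
      ((integrable_const _).indicator hTm)
      (pLip_annularCutoff_rpow_le A hA ha hab hb hr0)).trans_eq ?_
    rw [integral_indicator_const _ hTm, smul_eq_mul, mul_comm]
  have hpos : 0 < (υ.real A - δ) ^ r := Real.rpow_pos_of_pos hd0 r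
  rw [ENNReal.ofReal_div_of_pos hpos]
  refine (ENNReal.le_div_iff_mul_le (Or.inl (by simpa using hpos))
    (Or.inl ENNReal.ofReal_ne_top)).2 ?_
  calc lambda1 υ r * ENNReal.ofReal ((υ.real A - δ) ^ r)
      ≤ lambda1 υ r * ENNReal.ofReal (∫ x, |annularCutoff A a b x - c| ^ r ∂υ) := by gcongr
    _ ≤ _ := hc.trans (ENNReal.ofReal_le_ofReal hE)

lemma eventually_lambda1_lt_of_cheeger_lt [CompactSpace X] [IsProbabilityMeasure υ] {M : ℝ≥0∞}
    (hM : cheeger υ < M) : ∀ᶠ r in 𝓝[>] (1:ℝ), lambda1 υ r < M := by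
  obtain ⟨A, hA⟩ := iInf_lt_iff.1 hM
  obtain ⟨⟨hAm, hA0, hhalf⟩, hlt⟩ := iInf_lt_iff.1 hA
  obtain ⟨M', hM'1, hM'2⟩ := exists_between hlt
  have hM'top : M' ≠ ⊤ := (hM'2.trans_le le_top).ne
  have hAtop : υ A ≠ ⊤ := measure_ne_top υ A
  have hne : A.Nonempty := nonempty_of_measure_ne_zero hA0.ne'
  have hhalf' : υ.real A ≤ 1 / 2 := by
    have := ENNReal.toReal_mono (by simp) hhalf
    simpa [Measure.real] using this
  have ha0 : 0 < υ.real A := ENNReal.toReal_pos hA0.ne' hAtop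
  have hmink : minkBoundary υ A < M' * υ A :=
    (ENNReal.div_lt_iff (Or.inl hA0.ne') (Or.inl hAtop)).1 hM'1
  obtain ⟨b', hb'1, hb'2⟩ := exists_between hmink
  have hb'top : b' ≠ ⊤ := (hb'2.trans_le le_top).ne
  set m := M'.toReal with hm
  set β := b'.toReal with hβ
  have hβm : β < m * υ.real A := by
    have := ENNReal.toReal_strict_mono (ENNReal.mul_ne_top hM'top hAtop) hb'2
    rwa [ENNReal.toReal_mul] at this
  have hβ0 : 0 < β := ENNReal.toReal_pos (bot_lt_iff_ne_bot.1 (bot_le.trans_lt hb'1)) hb'top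
  have hfreq : ∃ᶠ ρ in 𝓝[>] (0:ℝ), (υ (thickening ρ A) - υ A) / ENNReal.ofReal ρ < b' :=
    frequently_lt_of_liminf_lt (by isBoundedDefault) hb'1
  have hev : ∀ᶠ ρ in 𝓝[>] (0:ℝ), β < m * (υ.real A - β * ρ) ∧ β * ρ < υ.real A := by
    have c1 : Tendsto (fun ρ : ℝ => m * (υ.real A - β * ρ)) (𝓝 0)
        (𝓝 (m * (υ.real A - β * 0))) := Continuous.tendsto (by fun_prop) 0
    have c2 : Tendsto (fun ρ : ℝ => β * ρ) (𝓝 0) (𝓝 (β * 0)) :=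
      Continuous.tendsto (by fun_prop) 0
    refine Eventually.filter_mono nhdsWithin_le_nhds ?_
    exact (c1.eventually (lt_mem_nhds (by simpa using hβm))).and
      (c2.eventually (gt_mem_nhds (by simpa using ha0)))
  obtain ⟨ρ, hρ1, ⟨hρ2, hρ3⟩, hρ0⟩ :=
    (hfreq.and_eventually (hev.and self_mem_nhdsWithin)).exists
  have hρ0 : 0 < ρ := hρ0
  set δ := υ.real (thickening ρ A \ A) with hδ
  have hδ0 : 0 ≤ δ := measureReal_nonneg
  have hδρ : δ < β * ρ := by
    have h1 : υ (thickening ρ A \ A) = υ (thickening ρ A) - υ A :=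
      measure_sdiff (self_subset_thickening hρ0 A) hAm.nullMeasurableSet hAtop
    have h2 : υ (thickening ρ A \ A) < b' * ENNReal.ofReal ρ := by
      rw [h1]
      exact (ENNReal.div_lt_iff (Or.inl (by simpa using hρ0))
        (Or.inl ENNReal.ofReal_ne_top)).1 hρ1
    have := ENNReal.toReal_strict_mono (ENNReal.mul_ne_top hb'top ENNReal.ofReal_ne_top) h2
    rwa [ENNReal.toReal_mul, ENNReal.toReal_ofReal hρ0.le] at this
  have hδa : δ < υ.real A := hδρ.trans hρ3
  have hm0 : 0 ≤ m := ENNReal.toReal_nonneg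
  have hmain : δ < ρ * (m * (υ.real A - δ)) := by
    have h1 : m * (υ.real A - β * ρ) ≤ m * (υ.real A - δ) := by gcongr
    nlinarith
  obtain ⟨η, ⟨hη1, hη2⟩, hη0⟩ : ∃ η : ℝ, (δ < (1 - 2 * η) * ρ * (m * (υ.real A - δ)) ∧
      η < 1 / 2) ∧ 0 < η := by
    have c1 : Tendsto (fun η : ℝ => (1 - 2 * η) * ρ * (m * (υ.real A - δ))) (𝓝 0)
        (𝓝 ((1 - 2 * 0) * ρ * (m * (υ.real A - δ)))) := Continuous.tendsto (by fun_prop) 0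
    have h1 : ∀ᶠ η in 𝓝[>] (0:ℝ), δ < (1 - 2 * η) * ρ * (m * (υ.real A - δ)) :=
      (c1.eventually (lt_mem_nhds (by simpa using hmain))).filter_mono nhdsWithin_le_nhds
    have h2 : ∀ᶠ η in 𝓝[>] (0:ℝ), η < 1 / 2 :=
      Eventually.filter_mono nhdsWithin_le_nhds (gt_mem_nhds (by norm_num))
    exact ((h1.and h2).and self_mem_nhdsWithin).exists
  set k := 1 / ((1 - η) * ρ - η * ρ) with hk
  have hden : (1 - η) * ρ - η * ρ = (1 - 2 * η) * ρ := by ring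
  have hden0 : 0 < (1 - 2 * η) * ρ := mul_pos (by linarith) hρ0
  have hk0 : 0 < k := by rw [hk, hden]; positivity
  have hd0 : 0 < υ.real A - δ := by linarith
  have hone : k ^ (1:ℝ) * δ / (υ.real A - δ) ^ (1:ℝ) < m := by
    rw [Real.rpow_one, Real.rpow_one, div_lt_iff₀ hd0, hk, hden, one_div, inv_mul_eq_div,
      div_lt_iff₀ hden0]
    linarith
  have hcont : ContinuousAt (fun r : ℝ => k ^ r * δ / (υ.real A - δ) ^ r) 1 := by
    refine ContinuousAt.div ?_ (Real.continuousAt_const_rpow hd0.ne')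
      (Real.rpow_pos_of_pos hd0 _).ne'
    exact (Real.continuousAt_const_rpow hk0.ne').mul continuousAt_const
  filter_upwards [(hcont.eventually (gt_mem_nhds hone)).filter_mono nhdsWithin_le_nhds,
    self_mem_nhdsWithin] with r hr hr1
  refine (lambda1_le_of_annulus υ hAm hne hhalf' (a := η * ρ) (b := (1 - η) * ρ) (ρ := ρ)
    (by positivity) (by nlinarith) (by nlinarith) hδa hr1).trans_lt ?_
  refine lt_of_le_of_lt ?_ hM'2
  rw [← ENNReal.ofReal_toReal hM'top]
  exact ENNReal.ofReal_le_ofReal hr.le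

end CheegerUpperBound

section SobolevPoincare

section Doubling

variable [MeasurableSpace X] {υ : Measure X} {κ : ℝ}

lemma DoublingFor.measureReal_ball_two_mul_le [IsFiniteMeasure υ] (h : DoublingFor υ κ) (x : X)
    {r : ℝ} (hr : 0 < r) : υ.real (ball x (2 * r)) ≤ 2 ^ κ * υ.real (ball x r) := by
  have htop : (2:ℝ≥0∞) ^ κ ≠ ⊤ := by simp
  have := ENNReal.toReal_mono (ENNReal.mul_ne_top htop (measure_ne_top υ _)) (h x r hr)
  rwa [ENNReal.toReal_mul, ← ENNReal.toReal_rpow, ENNReal.toReal_ofNat] at this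

/-- In a space covered by balls of radius `R`, doubling bounds ball masses from below. -/
lemma DoublingFor.one_le_pow_mul_measureReal_ball [IsProbabilityMeasure υ] (h : DoublingFor υ κ)
    {R : ℝ} (hR0 : 0 < R) (hR : ∀ x : X, ball x R = univ) (x : X) (n : ℕ) :
    1 ≤ ((2:ℝ) ^ κ) ^ n * υ.real (ball x (R / 2 ^ n)) := by
  induction n with
  | zero => simp [hR x]
  | succ n ih =>
    have h1 := h.measureReal_ball_two_mul_le x (r := R / 2 ^ (n + 1)) (by positivity)
    have h2 : 2 * (R / 2 ^ (n + 1)) = R / 2 ^ n := by field_simp; ring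
    rw [h2] at h1
    calc (1:ℝ) ≤ ((2:ℝ) ^ κ) ^ n * υ.real (ball x (R / 2 ^ n)) := ih
      _ ≤ ((2:ℝ) ^ κ) ^ n * (2 ^ κ * υ.real (ball x (R / 2 ^ (n + 1)))) := by gcongr
      _ = _ := by ring

lemma DoublingFor.measureReal_ball_pos [IsProbabilityMeasure υ] (h : DoublingFor υ κ)
    {R : ℝ} (hR0 : 0 < R) (hR : ∀ x : X, ball x R = univ) (x : X) (n : ℕ) :
    0 < υ.real (ball x (R / 2 ^ n)) := by
  have h1 := h.one_le_pow_mul_measureReal_ball hR0 hR x n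
  exact (pos_iff_pos_of_mul_pos (zero_lt_one.trans_le h1)).1 (by positivity)

end Doubling

section BallAverage

variable [MeasurableSpace X] (υ : Measure X)

/-- The average of `g` over the ball of radius `r` centred at `x`. -/
noncomputable def ballAverage (r : ℝ) (g : X → ℝ≥0∞) (x : X) : ℝ≥0∞ :=
  (∫⁻ y in ball x r, g y ∂υ) / υ (ball x r)

variable [BorelSpace X] [SecondCountableTopology X]

lemma measurableSet_dist_lt (r : ℝ) : MeasurableSet {z : X × X | dist z.2 z.1 < r} :=
  (isOpen_lt (continuous_snd.dist continuous_fst) continuous_const).measurableSet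

lemma measurable_measure_ball [SFinite υ] (r : ℝ) : Measurable fun x : X => υ (ball x r) :=
  measurable_measure_prodMk_left (measurableSet_dist_lt r)

lemma measurable_ballAverage [SFinite υ] (r : ℝ) {g : X → ℝ≥0∞} (hg : Measurable g) :
    Measurable (ballAverage υ r g) := by
  refine Measurable.div ?_ (measurable_measure_ball υ r)
  have h : ∀ x, ∫⁻ y in ball x r, g y ∂υ =
      ∫⁻ y, ({z : X × X | dist z.2 z.1 < r}.indicator fun z => g z.2) (x, y) ∂υ := fun x =>
    (lintegral_indicator measurableSet_ball _).symm
  simp_rw [h]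
  exact ((hg.comp measurable_snd).indicator (measurableSet_dist_lt r)).lintegral_prod_right'

lemma lintegral_ballAverage_le [IsFiniteMeasure υ] {κ : ℝ} (hdoub : DoublingFor υ κ) {r : ℝ}
    (hr : 0 < r) (hpos : ∀ x, υ (ball x r) ≠ 0) {g : X → ℝ≥0∞} (hg : Measurable g) :
    ∫⁻ x, ballAverage υ r g x ∂υ ≤ (2:ℝ≥0∞) ^ κ * ∫⁻ x, g x ∂υ := by
  set F : X → X → ℝ≥0∞ := fun x y =>
    ({z : X × X | dist z.2 z.1 < r}.indicator fun z => g z.2 * (υ (ball z.1 r))⁻¹) (x, y) with hF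
  have hFm : Measurable (Function.uncurry F) :=
    ((hg.comp measurable_snd).mul ((measurable_measure_ball υ r).comp measurable_fst).inv).indicator
      (measurableSet_dist_lt r)
  have h1 : ∀ x, ballAverage υ r g x = ∫⁻ y, F x y ∂υ := by
    intro x
    have : ∀ y, F x y = (ball x r).indicator (fun y => g y * (υ (ball x r))⁻¹) y := fun y => rfl
    simp_rw [this]
    rw [lintegral_indicator measurableSet_ball, lintegral_mul_const _ hg, ballAverage,
      div_eq_mul_inv]
  simp_rw [h1]
  rw [lintegral_lintegral_swap hFm.aemeasurable, ← lintegral_const_mul _ hg]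
  refine lintegral_mono fun y => ?_
  have h2 : ∀ x, F x y ≤ (ball y r).indicator
      (fun _ => g y * ((2:ℝ≥0∞) ^ κ * (υ (ball y r))⁻¹)) x := by
    intro x
    by_cases hx : dist y x < r
    · have hxb : x ∈ ball y r := by rwa [mem_ball']
      have e1 : F x y = g y * (υ (ball x r))⁻¹ := indicator_of_mem (s := {z : X × X |
        dist z.2 z.1 < r}) (show (x, y) ∈ {z : X × X | dist z.2 z.1 < r} from hx) _
      rw [e1, indicator_of_mem hxb]
      gcongr
      have h3 : υ (ball y r) ≤ (2:ℝ≥0∞) ^ κ * υ (ball x r) := by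
        refine (measure_mono (ball_subset_ball' ?_)).trans (hdoub x r hr)
        linarith
      rw [ENNReal.inv_le_iff_inv_le, ENNReal.mul_inv (Or.inr (by simp [hpos])) (Or.inl (by simp)),
        inv_inv, ← ENNReal.div_eq_inv_mul]
      exact ENNReal.div_le_of_le_mul' h3
    · have e1 : F x y = 0 := indicator_of_notMem (s := {z : X × X |
        dist z.2 z.1 < r}) (show (x, y) ∉ {z : X × X | dist z.2 z.1 < r} from hx) _
      rw [e1]
      exact zero_le
  refine (lintegral_mono h2).trans_eq ?_
  rw [lintegral_indicator_const measurableSet_ball, mul_assoc, mul_assoc,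
    ENNReal.inv_mul_cancel (hpos y) (measure_ne_top υ _), mul_one, mul_comm]

end BallAverage

section Telescoping

lemma abs_setAverage_sub_le {Ω : Type*} [MeasurableSpace Ω] {μ : Measure Ω} [IsFiniteMeasure μ]
    {f : Ω → ℝ} (hi : Integrable f μ) {s : Set Ω} (hs : 0 < μ.real s) (c : ℝ) :
    |(⨍ y in s, f y ∂μ) - c| ≤ ⨍ y in s, |f y - c| ∂μ := by
  have h1 : (⨍ y in s, f y ∂μ) - c = ⨍ y in s, (f y - c) ∂μ := by
    rw [setAverage_eq, setAverage_eq, integral_sub hi.integrableOn (integrable_const c),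
      setIntegral_const, smul_sub, smul_eq_mul, smul_eq_mul, smul_eq_mul,
      inv_mul_cancel_left₀ hs.ne']
  rw [h1, setAverage_eq, setAverage_eq, smul_eq_mul, smul_eq_mul, abs_mul,
    abs_of_pos (inv_pos.2 hs)]
  gcongr
  exact abs_integral_le_integral_abs

lemma PoincareFor.abs_setAverage_half_ball_sub_le [MeasurableSpace X]
    {υ : Measure X} [IsFiniteMeasure υ] {κ q τ : ℝ} (hdoub : DoublingFor υ κ)
    (hpoin : PoincareFor υ 1 q τ) {f : X → ℝ} {K : ℝ≥0} (hf : LipschitzWith K f)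
    (hi : Integrable f υ) {x : X} {r : ℝ} (hr : 0 < r) (hpos : 0 < υ.real (ball x r)) :
    |(⨍ y in ball x r, f y ∂υ) - ⨍ y in ball x (2 * r), f y ∂υ| ≤
      2 ^ κ * (τ * (2 * r) * (⨍ y in ball x (2 * r), pLip f y ^ q ∂υ) ^ (1 / q)) := by
  have hp := hpoin x (2 * r) (by positivity) f ⟨K, hf⟩
  simp only [Real.rpow_one, one_div_one] at hp
  set c := ⨍ y in ball x (2 * r), f y ∂υ with hc
  refine (abs_setAverage_sub_le hi hpos c).trans (le_trans ?_
    (mul_le_mul_of_nonneg_left hp (by positivity)))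
  have hsub : ball x r ⊆ ball x (2 * r) := ball_subset_ball (by linarith)
  have hpos2 : 0 < υ.real (ball x (2 * r)) := hpos.trans_le (measureReal_mono hsub)
  rw [setAverage_eq, setAverage_eq, smul_eq_mul, smul_eq_mul, ← mul_assoc]
  have hi' : Integrable (fun y => |f y - c|) υ := (hi.sub (integrable_const _)).abs
  refine mul_le_mul ?_ (setIntegral_mono_set hi'.integrableOn
    (Eventually.of_forall fun y => abs_nonneg _) hsub.eventuallyLE)
    (integral_nonneg fun y => abs_nonneg _) (by positivity)
  have h1 := hdoub.measureReal_ball_two_mul_le x hr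
  rw [inv_eq_one_div, ← div_eq_mul_inv, div_le_div_iff₀ hpos hpos2]
  linarith

variable [MeasurableSpace X] [BorelSpace X] {υ : Measure X} [IsProbabilityMeasure υ]

lemma LipschitzWith.integrable_of_ball_eq_univ {f : X → ℝ} {K : ℝ≥0} (hf : LipschitzWith K f)
    {R : ℝ} (hR : ∀ x : X, ball x R = univ) : Integrable f υ := by
  obtain ⟨x₀⟩ : Nonempty X := nonempty_of_isProbabilityMeasure υ
  refine Integrable.of_bound hf.continuous.measurable.aestronglyMeasurable (|f x₀| + K * R)
    (Eventually.of_forall fun x => ?_)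
  have h1 : dist x x₀ < R := by
    have : x ∈ ball x₀ R := by rw [hR]; trivial
    exact this
  have h2 : |f x - f x₀| ≤ K * dist x x₀ := by simpa [Real.dist_eq] using hf.dist_le_mul x x₀
  have h3 : (K:ℝ) * dist x x₀ ≤ K * R := by gcongr
  have h4 := abs_sub_abs_le_abs_sub (f x) (f x₀)
  rw [Real.norm_eq_abs]
  linarith

lemma abs_sub_setAverage_ball_le {f : X → ℝ} {K : ℝ≥0} (hf : LipschitzWith K f)
    (hi : Integrable f υ) {x : X} {r : ℝ} (hpos : 0 < υ.real (ball x r)) :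
    |f x - ⨍ y in ball x r, f y ∂υ| ≤ K * r := by
  rw [abs_sub_comm]
  refine (abs_setAverage_sub_le hi hpos (f x)).trans ?_
  rw [setAverage_eq, smul_eq_mul, inv_mul_eq_div, div_le_iff₀ hpos]
  have hi' : IntegrableOn (fun y => |f y - f x|) (ball x r) υ :=
    (hi.sub (integrable_const _)).abs.integrableOn
  calc ∫ y in ball x r, |f y - f x| ∂υ ≤ ∫ y in ball x r, K * r ∂υ := by
        refine setIntegral_mono_on hi' (integrable_const _) measurableSet_ball fun y hy => ?_
        have h2 : |f y - f x| ≤ K * dist y x := by simpa [Real.dist_eq] using hf.dist_le_mul y x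
        exact h2.trans (by gcongr; exact (le_of_lt hy))
    _ = _ := by rw [setIntegral_const, smul_eq_mul, mul_comm]

lemma ofReal_setAverage_pLip_rpow {f : X → ℝ} {K : ℝ≥0} (hf : LipschitzWith K f) {q : ℝ}
    (hq : 0 ≤ q) (x : X) (r : ℝ) :
    ENNReal.ofReal (⨍ y in ball x r, pLip f y ^ q ∂υ) =
      ballAverage υ r (fun y => ENNReal.ofReal (pLip f y ^ q)) x :=
  ofReal_setAverage (integrable_pLip_rpow υ hf hq).integrableOn
    (Eventually.of_forall fun y => Real.rpow_nonneg (pLip_nonneg f y) q)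

/-- Pointwise control of `f` minus its mean by a finite chain of ball averages. -/
lemma PoincareFor.ofReal_abs_sub_integral_le {κ q τ R : ℝ} (hq : 0 < q) (hτ : 0 < τ)
    (hdoub : DoublingFor υ κ) (hpoin : PoincareFor υ 1 q τ) (hR0 : 0 < R)
    (hR : ∀ x : X, ball x R = univ) {f : X → ℝ} {K : ℝ≥0} (hf : LipschitzWith K f) (x : X)
    (n : ℕ) :
    ENNReal.ofReal |f x - ∫ y, f y ∂υ| ≤
      (∑ i ∈ Finset.range n, ENNReal.ofReal (2 ^ κ * τ * R / 2 ^ i) *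
        ballAverage υ (R / 2 ^ i) (fun y => ENNReal.ofReal (pLip f y ^ q)) x ^ (1 / q)) +
        ENNReal.ofReal (K * (R / 2 ^ n)) := by
  have hi : Integrable f υ := hf.integrable_of_ball_eq_univ hR
  have hpos := fun i => hdoub.measureReal_ball_pos hR0 hR x i
  set T : ℕ → ℝ := fun i => ⨍ y in ball x (R / 2 ^ i), f y ∂υ with hT
  set A : ℕ → ℝ := fun i => ⨍ y in ball x (R / 2 ^ i), pLip f y ^ q ∂υ with hA
  have hA0 : ∀ i, 0 ≤ A i := fun i => by
    rw [hA]
    dsimp only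
    rw [setAverage_eq, smul_eq_mul]
    exact mul_nonneg (by positivity)
      (integral_nonneg fun y => Real.rpow_nonneg (pLip_nonneg f y) q)
  have hstep : ∀ i, |T (i + 1) - T i| ≤ 2 ^ κ * τ * R / 2 ^ i * A i ^ (1 / q) := by
    intro i
    have h2 : 2 * (R / 2 ^ (i + 1)) = R / 2 ^ i := by field_simp; ring
    have := hpoin.abs_setAverage_half_ball_sub_le hdoub hf hi (x := x)
      (r := R / 2 ^ (i + 1)) (by positivity) (hpos (i + 1))
    rw [h2] at this
    refine this.trans_eq ?_
    ring
  have htel : ∀ n, |T n - T 0| ≤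
      ∑ i ∈ Finset.range n, 2 ^ κ * τ * R / 2 ^ i * A i ^ (1 / q) := by
    intro n
    rw [← Finset.sum_range_sub]
    exact (Finset.abs_sum_le_sum_abs _ _).trans (Finset.sum_le_sum fun i _ => hstep i)
  have hT0 : T 0 = ∫ y, f y ∂υ := by
    simp [hT, hR x, average_eq_integral]
  have hn : |f x - T n| ≤ K * (R / 2 ^ n) := abs_sub_setAverage_ball_le hf hi (hpos n)
  have hterm : ∀ i ∈ Finset.range n, 0 ≤ 2 ^ κ * τ * R / 2 ^ i * A i ^ (1 / q) := fun i _ =>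
    mul_nonneg (by positivity) (Real.rpow_nonneg (hA0 i) _)
  have htotal : |f x - ∫ y, f y ∂υ| ≤
      (∑ i ∈ Finset.range n, 2 ^ κ * τ * R / 2 ^ i * A i ^ (1 / q)) + K * (R / 2 ^ n) := by
    rw [← hT0]
    have := abs_sub_le (f x) (T n) (T 0)
    linarith [htel n]
  refine (ENNReal.ofReal_le_ofReal htotal).trans_eq ?_
  rw [ENNReal.ofReal_add (Finset.sum_nonneg hterm) (by positivity),
    ENNReal.ofReal_sum_of_nonneg hterm]
  congr 1
  refine Finset.sum_congr rfl fun i _ => ?_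
  rw [ENNReal.ofReal_mul (by positivity),
    ← ENNReal.ofReal_rpow_of_nonneg (hA0 i) (by positivity), hA]
  dsimp only
  rw [ofReal_setAverage_pLip_rpow hf hq.le]

end Telescoping

section StrongType

lemma ballAverage_le [MeasurableSpace X] {υ : Measure X} [IsProbabilityMeasure υ] {κ R : ℝ}
    (hdoub : DoublingFor υ κ) (hR0 : 0 < R) (hR : ∀ x : X, ball x R = univ) (g : X → ℝ≥0∞)
    (x : X) (i : ℕ) :
    ballAverage υ (R / 2 ^ i) g x ≤ ENNReal.ofReal ((2 ^ κ) ^ i) * ∫⁻ y, g y ∂υ := by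
  have h1 := hdoub.one_le_pow_mul_measureReal_ball hR0 hR x i
  refine ENNReal.div_le_of_le_mul ?_
  calc ∫⁻ y in ball x (R / 2 ^ i), g y ∂υ ≤ ∫⁻ y, g y ∂υ := setLIntegral_le_lintegral _ _
    _ = ENNReal.ofReal 1 * ∫⁻ y, g y ∂υ := by simp
    _ ≤ ENNReal.ofReal ((2 ^ κ) ^ i * υ.real (ball x (R / 2 ^ i))) * ∫⁻ y, g y ∂υ := by
        gcongr
    _ = _ := by
        rw [ENNReal.ofReal_mul (by positivity), ofReal_measureReal]
        ring

variable [MeasurableSpace X] [BorelSpace X] [SecondCountableTopology X] {υ : Measure X}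
  [IsProbabilityMeasure υ]

lemma lintegral_ballAverage_rpow_le {κ R t Γ : ℝ} (hdoub : DoublingFor υ κ) (hR0 : 0 < R)
    (hR : ∀ x : X, ball x R = univ) (ht : 1 ≤ t) (hΓ : 0 ≤ Γ) {g : X → ℝ≥0∞} (hg : Measurable g)
    (hgΓ : ∫⁻ y, g y ∂υ = ENNReal.ofReal Γ) (i : ℕ) :
    ∫⁻ x, ballAverage υ (R / 2 ^ i) g x ^ t ∂υ ≤
      ENNReal.ofReal (((2 ^ κ) ^ i) ^ (t - 1) * 2 ^ κ * Γ ^ t) := by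
  have hle : ∀ x, ballAverage υ (R / 2 ^ i) g x ≤ ENNReal.ofReal ((2 ^ κ) ^ i * Γ) := fun x => by
    rw [ENNReal.ofReal_mul (by positivity), ← hgΓ]
    exact ballAverage_le hdoub hR0 hR g x i
  have hpos : ∀ x, υ (ball x (R / 2 ^ i)) ≠ 0 := fun x h0 => by
    have := hdoub.measureReal_ball_pos hR0 hR x i
    simp [Measure.real, h0] at this
  have h2κ : (2:ℝ≥0∞) ^ κ = ENNReal.ofReal (2 ^ κ) := by
    rw [← ENNReal.ofReal_rpow_of_pos (by norm_num), ENNReal.ofReal_ofNat]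
  calc ∫⁻ x, ballAverage υ (R / 2 ^ i) g x ^ t ∂υ
      ≤ ∫⁻ x, ENNReal.ofReal (((2 ^ κ) ^ i * Γ) ^ (t - 1)) * ballAverage υ (R / 2 ^ i) g x ∂υ := by
        refine lintegral_mono fun x => ?_
        have e : ballAverage υ (R / 2 ^ i) g x ^ t =
            ballAverage υ (R / 2 ^ i) g x ^ (t - 1) * ballAverage υ (R / 2 ^ i) g x := by
          nth_rewrite 3 [← ENNReal.rpow_one (ballAverage υ (R / 2 ^ i) g x)]
          rw [← ENNReal.rpow_add_of_nonneg _ _ (by linarith) zero_le_one, sub_add_cancel]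
        rw [e, ← ENNReal.ofReal_rpow_of_nonneg (by positivity) (by linarith)]
        gcongr
        exact hle x
    _ = ENNReal.ofReal (((2 ^ κ) ^ i * Γ) ^ (t - 1)) * ∫⁻ x, ballAverage υ (R / 2 ^ i) g x ∂υ :=
        lintegral_const_mul' _ _ ENNReal.ofReal_ne_top
    _ ≤ ENNReal.ofReal (((2 ^ κ) ^ i * Γ) ^ (t - 1)) *
          (ENNReal.ofReal (2 ^ κ) * ENNReal.ofReal Γ) := by
        gcongr
        rw [← h2κ, ← hgΓ]
        exact lintegral_ballAverage_le υ hdoub (by positivity) hpos hg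
    _ = _ := by
        rw [← ENNReal.ofReal_mul (by positivity), ← ENNReal.ofReal_mul (by positivity),
          Real.mul_rpow (by positivity) hΓ]
        congr 1
        have e : Γ ^ t = Γ ^ (t - 1) * Γ := by
          rw [← Real.rpow_add_one' hΓ (by linarith), sub_add_cancel]
        rw [e]; ring

lemma lintegral_sum_rpow_le {ι Ω : Type*} [MeasurableSpace Ω] (μ : Measure Ω) {s : ℝ}
    (hs : 1 ≤ s) (J : Finset ι) {F : ι → Ω → ℝ≥0∞} (hF : ∀ i, Measurable (F i)) :
    (∫⁻ x, (∑ i ∈ J, F i x) ^ s ∂μ) ^ (1 / s) ≤ ∑ i ∈ J, (∫⁻ x, F i x ^ s ∂μ) ^ (1 / s) := by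
  have hs0 : 0 < s := by linarith
  induction J using Finset.induction_on with
  | empty => simp [ENNReal.zero_rpow_of_pos hs0, hs0]
  | insert a J ha ih =>
    simp_rw [Finset.sum_insert ha]
    have h := ENNReal.lintegral_Lp_add_le (μ := μ) (hF a).aemeasurable
      (Finset.measurable_sum J fun i _ => hF i).aemeasurable hs
    simp only [Pi.add_apply] at h
    exact h.trans (by gcongr)

theorem exists_sobolev_poincare [CompactSpace X] {κ q τ : ℝ} (hq : 1 ≤ q) (hκ : 0 < κ)
    (hτ : 0 < τ) (hdoub : DoublingFor υ κ) (hpoin : PoincareFor υ 1 q τ) :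
    ∃ s C : ℝ, q < s ∧ 0 ≤ C ∧ ∀ (f : X → ℝ) (K : ℝ≥0), LipschitzWith K f →
      ∫ x, |f x - ∫ y, f y ∂υ| ^ s ∂υ ≤ C * (∫ x, pLip f x ^ q ∂υ) ^ (s / q) := by
  have hq0 : 0 < q := by linarith
  obtain ⟨R, hR0, hR⟩ : ∃ R : ℝ, 0 < R ∧ ∀ x : X, ball x R = univ := by
    refine ⟨diam (univ : Set X) + 1, by positivity, fun x => eq_univ_of_forall fun y => ?_⟩
    rw [mem_ball]
    linarith [dist_le_diam_of_mem isCompact_univ.isBounded (mem_univ y) (mem_univ x)]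
  set s := q + 1 / (2 * κ) with hs
  have hqs : q < s := by rw [hs]; linarith [show 0 < 1 / (2 * κ) by positivity]
  have hs1 : 1 ≤ s := by linarith
  have hs0 : 0 < s := by linarith
  set t := s / q with ht
  have ht1 : 1 ≤ t := (one_le_div hq0).2 hqs.le
  set β : ℝ := (2 ^ κ) ^ ((t - 1) / s) / 2 with hβ
  have hβ0 : 0 < β := by positivity
  have hβ1 : β < 1 := by
    have hexp : κ * ((t - 1) / s) < 1 := by
      have e : κ * ((t - 1) / s) = 1 / (2 * q * s) := by
        rw [ht, hs]; field_simp; ring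
      rw [e, div_lt_one (by positivity)]
      nlinarith
    rw [hβ, div_lt_one two_pos, ← Real.rpow_mul two_pos.le]
    calc (2:ℝ) ^ (κ * ((t - 1) / s)) < 2 ^ (1:ℝ) :=
          Real.rpow_lt_rpow_of_exponent_lt (by norm_num) hexp
      _ = 2 := Real.rpow_one 2
  set C₁ : ℝ := 2 ^ κ * τ * R * (2 ^ κ) ^ (1 / s) * (1 - β)⁻¹ with hC₁
  have hC₁0 : 0 ≤ C₁ := by
    have : 0 < 1 - β := by linarith
    positivity
  refine ⟨s, C₁ ^ s, hqs, by positivity, fun f K hf => ?_⟩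
  set Γ := ∫ x, pLip f x ^ q ∂υ with hΓ
  have hΓ0 : 0 ≤ Γ := integral_nonneg fun x => Real.rpow_nonneg (pLip_nonneg f x) q
  set g : X → ℝ≥0∞ := fun y => ENNReal.ofReal (pLip f y ^ q) with hg
  have hgm : Measurable g := ((measurable_pLip hf).pow_const q).ennreal_ofReal
  have hgΓ : ∫⁻ y, g y ∂υ = ENNReal.ofReal Γ :=
    (ofReal_integral_eq_lintegral_ofReal (integrable_pLip_rpow υ hf hq0.le)
      (Eventually.of_forall fun y => Real.rpow_nonneg (pLip_nonneg f y) q)).symm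
  set F : ℕ → X → ℝ≥0∞ := fun i x => ENNReal.ofReal (2 ^ κ * τ * R / 2 ^ i) *
    ballAverage υ (R / 2 ^ i) g x ^ (1 / q) with hF
  have hFm : ∀ i, Measurable (F i) := fun i =>
    ((measurable_ballAverage υ _ hgm).pow_const _).const_mul _
  have hFi : ∀ i, (∫⁻ x, F i x ^ s ∂υ) ^ (1 / s) ≤
      ENNReal.ofReal (2 ^ κ * τ * R * (2 ^ κ) ^ (1 / s) * Γ ^ (1 / q) * β ^ i) := by
    intro i
    have e1 : ∀ x, F i x ^ s = ENNReal.ofReal (2 ^ κ * τ * R / 2 ^ i) ^ s *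
        ballAverage υ (R / 2 ^ i) g x ^ t := fun x => by
      rw [hF]
      dsimp only
      rw [ENNReal.mul_rpow_of_nonneg _ _ hs0.le, ← ENNReal.rpow_mul, one_div_mul_eq_div]
    simp_rw [e1]
    rw [lintegral_const_mul _ ((measurable_ballAverage υ _ hgm).pow_const _),
      ENNReal.mul_rpow_of_nonneg _ _ (by positivity), ← ENNReal.rpow_mul,
      mul_one_div_cancel hs0.ne', ENNReal.rpow_one]
    calc ENNReal.ofReal (2 ^ κ * τ * R / 2 ^ i) *
          (∫⁻ x, ballAverage υ (R / 2 ^ i) g x ^ t ∂υ) ^ (1 / s)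
        ≤ ENNReal.ofReal (2 ^ κ * τ * R / 2 ^ i) *
          ENNReal.ofReal (((2 ^ κ) ^ i) ^ (t - 1) * 2 ^ κ * Γ ^ t) ^ (1 / s) := by
          gcongr
          exact lintegral_ballAverage_rpow_le hdoub hR0 hR ht1 hΓ0 hgm hgΓ i
      _ = _ := by
          rw [ENNReal.ofReal_rpow_of_nonneg (by positivity) (by positivity),
            ← ENNReal.ofReal_mul (by positivity)]
          congr 1
          have e2 : (Γ ^ t) ^ (1 / s) = Γ ^ (1 / q) := by
            rw [← Real.rpow_mul hΓ0]; congr 1; rw [ht]; field_simp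
          have e3 : ((((2:ℝ) ^ κ) ^ i) ^ (t - 1)) ^ (1 / s) = (((2:ℝ) ^ κ) ^ ((t - 1) / s)) ^ i := by
            have ha : (0:ℝ) ≤ 2 ^ κ := by positivity
            rw [← Real.rpow_natCast, ← Real.rpow_natCast, ← Real.rpow_mul (by positivity),
              ← Real.rpow_mul ha, ← Real.rpow_mul ha]
            congr 1
            ring
          rw [Real.mul_rpow (by positivity) (by positivity),
            Real.mul_rpow (by positivity) (by positivity), e2, e3, hβ, div_pow]
          ring
  have hsum : ∀ n, (∫⁻ x, (∑ i ∈ Finset.range n, F i x) ^ s ∂υ) ^ (1 / s) ≤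
      ENNReal.ofReal (C₁ * Γ ^ (1 / q)) := by
    intro n
    refine (lintegral_sum_rpow_le υ hs1 _ hFm).trans ((Finset.sum_le_sum fun i _ => hFi i).trans ?_)
    rw [← ENNReal.ofReal_sum_of_nonneg fun i _ => by positivity, ← Finset.mul_sum]
    apply ENNReal.ofReal_le_ofReal
    have hgeom : ∑ i ∈ Finset.range n, β ^ i ≤ (1 - β)⁻¹ := by
      rw [← tsum_geometric_of_lt_one hβ0.le hβ1]
      exact (summable_geometric_of_lt_one hβ0.le hβ1).sum_le_tsum _ fun i _ => by positivity
    calc _ ≤ 2 ^ κ * τ * R * (2 ^ κ) ^ (1 / s) * Γ ^ (1 / q) * (1 - β)⁻¹ := by gcongr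
      _ = _ := by rw [hC₁]; ring
  have hbound : ∀ n : ℕ, (∫⁻ x, ENNReal.ofReal |f x - ∫ y, f y ∂υ| ^ s ∂υ) ^ (1 / s) ≤
      ENNReal.ofReal (C₁ * Γ ^ (1 / q) + K * (R / 2 ^ n)) := by
    intro n
    rw [ENNReal.ofReal_add (by positivity) (by positivity)]
    calc (∫⁻ x, ENNReal.ofReal |f x - ∫ y, f y ∂υ| ^ s ∂υ) ^ (1 / s)
        ≤ (∫⁻ x, ((∑ i ∈ Finset.range n, F i x) + ENNReal.ofReal (K * (R / 2 ^ n))) ^ s ∂υ)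
            ^ (1 / s) := by
          gcongr with x
          exact hpoin.ofReal_abs_sub_integral_le hq0 hτ hdoub hR0 hR hf x n
      _ ≤ (∫⁻ x, (∑ i ∈ Finset.range n, F i x) ^ s ∂υ) ^ (1 / s) +
            (∫⁻ _, ENNReal.ofReal (K * (R / 2 ^ n)) ^ s ∂υ) ^ (1 / s) :=
          ENNReal.lintegral_Lp_add_le (Finset.measurable_fun_sum _ fun i _ => hFm i).aemeasurable
            aemeasurable_const hs1
      _ ≤ _ := by
          gcongr
          · exact hsum n
          · rw [lintegral_const, measure_univ, mul_one, ← ENNReal.rpow_mul,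
              mul_one_div_cancel hs0.ne', ENNReal.rpow_one]
  have hlim : Tendsto (fun n : ℕ => ENNReal.ofReal (C₁ * Γ ^ (1 / q) + K * (R / 2 ^ n))) atTop
      (𝓝 (ENNReal.ofReal (C₁ * Γ ^ (1 / q) + K * 0))) := by
    refine (ENNReal.continuous_ofReal.tendsto _).comp (tendsto_const_nhds.add
      (Tendsto.const_mul _ ?_))
    exact tendsto_const_nhds.div_atTop (tendsto_pow_atTop_atTop_of_one_lt one_lt_two)
  have hfin := ge_of_tendsto' hlim hbound
  rw [mul_zero, add_zero] at hfin
  have hcont : Continuous fun x => |f x - ∫ y, f y ∂υ| ^ s :=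
    continuous_abs_sub_rpow hf.continuous _ hs0.le
  have hconv : ∫⁻ x, ENNReal.ofReal |f x - ∫ y, f y ∂υ| ^ s ∂υ =
      ENNReal.ofReal (∫ x, |f x - ∫ y, f y ∂υ| ^ s ∂υ) := by
    rw [ofReal_integral_eq_lintegral_ofReal (hcont.integrable_of_compactSpace υ)
      (Eventually.of_forall fun x => by positivity)]
    exact lintegral_congr fun x => ENNReal.ofReal_rpow_of_nonneg (abs_nonneg _) hs0.le
  have hI0 : 0 ≤ ∫ x, |f x - ∫ y, f y ∂υ| ^ s ∂υ := integral_nonneg fun x => by positivity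
  rw [hconv, ENNReal.ofReal_rpow_of_nonneg hI0 (by positivity),
    ENNReal.ofReal_le_ofReal_iff (by positivity)] at hfin
  calc ∫ x, |f x - ∫ y, f y ∂υ| ^ s ∂υ
      = ((∫ x, |f x - ∫ y, f y ∂υ| ^ s ∂υ) ^ (1 / s)) ^ s := by
        rw [← Real.rpow_mul hI0, one_div_mul_cancel hs0.ne', Real.rpow_one]
    _ ≤ (C₁ * Γ ^ (1 / q)) ^ s := by gcongr
    _ = C₁ ^ s * Γ ^ (s / q) := by
        rw [Real.mul_rpow hC₁0 (by positivity), ← Real.rpow_mul hΓ0, one_div_mul_eq_div]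

end StrongType

end SobolevPoincare

section RightContinuity

variable [CompactSpace X] [MeasurableSpace X] [BorelSpace X] (υ : Measure X)
  [IsProbabilityMeasure υ]

lemma lam1_mul_integral_le {q : ℝ} (hq : 1 ≤ q) {f : X → ℝ} {K : ℝ≥0}
    (hf : LipschitzWith K f) :
    ∃ c : ℝ, lam1 υ q * ENNReal.ofReal (∫ x, |f x - c| ^ q ∂υ) ≤
      ENNReal.ofReal (∫ x, pLip f x ^ q ∂υ) := by
  rcases hq.eq_or_lt with rfl | hq
  · obtain ⟨c, hc⟩ := cheeger_mul_lintegral_abs_sub_le υ hf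
    refine ⟨c, ?_⟩
    have h1 : Integrable (fun x => |f x - c|) υ := by
      simpa using (continuous_abs_sub_rpow hf.continuous c zero_le_one).integrable_of_compactSpace υ
    have h2 : Integrable (pLip f) υ := by simpa using integrable_pLip_rpow υ hf zero_le_one
    simp only [Real.rpow_one, lam1, if_true]
    rwa [ofReal_integral_eq_lintegral_ofReal h1 (Eventually.of_forall fun x => abs_nonneg _),
      ofReal_integral_eq_lintegral_ofReal h2 (Eventually.of_forall fun x => pLip_nonneg f x)]
  · simp only [lam1, if_neg hq.ne']
    exact lambda1_mul_integral_le υ hq hf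

lemma eventually_lam1_lt {q : ℝ} (hq : 1 ≤ q) {M : ℝ≥0∞} (hM : lam1 υ q < M) :
    ∀ᶠ r in 𝓝[>] q, lam1 υ r < M := by
  have key : ∀ᶠ r in 𝓝[>] q, lambda1 υ r < M := by
    rcases hq.eq_or_lt with rfl | hq
    · exact eventually_lambda1_lt_of_cheeger_lt υ (by simpa [lam1] using hM)
    · exact eventually_lambda1_lt υ hq (by simpa only [lam1, if_neg hq.ne'] using hM)
  filter_upwards [key, self_mem_nhdsWithin] with r hr hqr
  rwa [lam1, if_neg (hq.trans_lt hqr).ne']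

lemma eventually_lt_lam1 {κ q τ : ℝ} (hq : 1 ≤ q) (hκ : 0 < κ) (hτ : 0 < τ)
    (hdoub : DoublingFor υ κ) (hpoin : PoincareFor υ 1 q τ) {M : ℝ≥0∞} (hM : M < lam1 υ q) :
    ∀ᶠ r in 𝓝[>] q, M < lam1 υ r := by
  obtain ⟨b, hb0, hMb, hbq⟩ := ENNReal.lt_iff_exists_real_btwn.1 hM
  have hb : 0 < b := ENNReal.ofReal_pos.1 (bot_le.trans_lt hMb)
  obtain ⟨s, C, hqs, hC, hS⟩ := exists_sobolev_poincare hq hκ hτ hdoub hpoin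
  have hA : ∀ (f : X → ℝ) (K : ℝ≥0), LipschitzWith K f →
      ∃ c : ℝ, ENNReal.ofReal b * ENNReal.ofReal (∫ x, |f x - c| ^ q ∂υ) ≤
        ENNReal.ofReal (∫ x, pLip f x ^ q ∂υ) := fun f K hf => by
    obtain ⟨c, hc⟩ := lam1_mul_integral_le υ hq hf
    exact ⟨c, le_trans (by gcongr) hc⟩
  set D : ℝ := 2 ^ s * (C + b⁻¹ ^ (s / q)) with hD
  have hD0 : 0 < D := by positivity
  have hsq : 0 < s - q := sub_pos.2 hqs
  have hlim : Tendsto (fun r : ℝ => ENNReal.ofReal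
      (b ^ ((s - r) / (s - q)) / D ^ (1 - (s - r) / (s - q)))) (𝓝[>] q) (𝓝 (ENNReal.ofReal b)) := by
    have hc : Continuous fun r : ℝ => ENNReal.ofReal
        (b ^ ((s - r) / (s - q)) / D ^ (1 - (s - r) / (s - q))) := by
      refine ENNReal.continuous_ofReal.comp (Continuous.div ?_ ?_ fun r => by positivity)
      · exact continuous_const.rpow (by fun_prop) fun r => Or.inl hb.ne'
      · exact continuous_const.rpow (by fun_prop) fun r => Or.inl hD0.ne'
    have := hc.tendsto q
    simp only [div_self hsq.ne', Real.rpow_one, sub_self, Real.rpow_zero, div_one] at this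
    exact this.mono_left nhdsWithin_le_nhds
  filter_upwards [hlim.eventually_const_lt hMb, Ioo_mem_nhdsGT hqs] with r hr hqr
  have hθ0 : 0 < (s - r) / (s - q) := div_pos (sub_pos.2 hqr.2) hsq
  have hθ1 : (s - r) / (s - q) < 1 := (div_lt_one hsq).2 (by linarith [hqr.1])
  have h := le_lambda1_of_sobolev υ hq hqs hb hC hS hA hθ0 hθ1
  have hr' : q * ((s - r) / (s - q)) + s * (1 - (s - r) / (s - q)) = r := by
    field_simp
    ring
  rw [hr'] at h
  rw [lam1, if_neg (hq.trans_lt hqr.1).ne']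
  exact hr.trans_le h

end RightContinuity

/-- right-continuity of `r ↦ λ_{1,r}(X)` at `q`, where `λ_{1,1} := h(X)`. -/
theorem stmt0 {X : Type*} [MetricSpace X] [CompactSpace X] [MeasurableSpace X] [BorelSpace X]
    (υ : Measure X) [IsProbabilityMeasure υ]
    (q : ℝ) (hq : 1 ≤ q) (hgeo : IsGeodesicSpace X)
    (κ : ℝ) (hκ : 0 < κ) (hdoub : DoublingFor υ κ)
    (τ : ℝ) (hτ : 0 < τ) (hpoin : PoincareFor υ 1 q τ) :
    Filter.Tendsto (fun r : ℝ => lam1 υ r) (𝓝[≥] q) (𝓝 (lam1 υ q)) := by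
  rw [← Ioi_insert, nhdsWithin_insert, tendsto_sup]
  refine ⟨tendsto_pure_nhds _ _, tendsto_order.2 ⟨fun M hM => ?_, fun M hM => ?_⟩⟩
  · exact eventually_lt_lam1 υ hq hκ hτ hdoub hpoin hM
  · exact eventually_lam1_lt υ hq hM
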